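/- arXiv:1908.02253 — 2 statements merged into one kernel-verified Lean document; each statement's English description precedes it below -/
import Mathlib

section
/- Let n ≥ 1 and 0 ≤ r ≤ n be integers, let A be a finite subset of ℕ_r^n, and let C be the initial segment of the ≤-order on ℕ_r^n with |C| = |A|. Then |d(A)| ≥ |d(C)|. -/
open Finset
open scoped Classical

/-- `R_i(x)`: the set of coordinates of `x` equal to `i`.
The ambient alphabet is `[k+1] = {0,…,k}`. -/
noncomputable def rset {k N : ℕ} (x : Fin N → Fin (k + 1)) (i : ℕ) : Finset (Fin N) :=
  Finset.univ.filter fun j => (x j : ℕ) = i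

/-- the strict binary order on finite sets of coordinates:
`X <_bin Y` iff `X ≠ Y` and `max (X Δ Y) ∈ Y`. -/
def binLT {N : ℕ} (X Y : Finset (Fin N)) : Prop :=
  ∃ m ∈ Y, m ∉ X ∧ ∀ j : Fin N, ((j ∈ X ∧ j ∉ Y) ∨ (j ∈ Y ∧ j ∉ X)) → j ≤ m

/-- the strict `≤`-order on `[k+1]^N`: `x < y` iff `|R_0(x)| > |R_0(y)|`, or
`|R_0(x)| = |R_0(y)|` and for the largest `i` with `R_i(x) ≠ R_i(y)` we have
`max (R_i(x) Δ R_i(y)) ∈ R_i(y)`. -/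
def plt {k N : ℕ} (x y : Fin N → Fin (k + 1)) : Prop :=
  (rset y 0).card < (rset x 0).card ∨
    ((rset x 0).card = (rset y 0).card ∧
      ∃ i : ℕ, binLT (rset x i) (rset y i) ∧ ∀ j : ℕ, i < j → rset x j = rset y j)

/-- the `≤`-order on `[k+1]^N`. -/
def ple {k N : ℕ} (x y : Fin N → Fin (k + 1)) : Prop := x = y ∨ plt x y

/-- `B` is an initial segment of the `≤`-order. -/
def isInitSeg {k N : ℕ} (B : Finset (Fin N → Fin (k + 1))) : Prop :=
  ∀ y ∈ B, ∀ x, ple x y → x ∈ B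

/-- the `d`-shadow: all points obtained from a point of `A` by flipping one
nonzero coordinate to `0`. -/
noncomputable def dShadow {k N : ℕ} (A : Finset (Fin N → Fin (k + 1))) :
    Finset (Fin N → Fin (k + 1)) :=
  A.biUnion fun x =>
    (Finset.univ.filter fun i => x i ≠ 0).image fun i => Function.update x i 0

/-- the initial segment of the `≤`-order on `[k+1]^N` of cardinality `m`. -/
noncomputable def initSeg (k N m : ℕ) : Finset (Fin N → Fin (k + 1)) :=
  Finset.univ.filter fun x => (Finset.univ.filter fun y => ple y x).card ≤ m

/-- the `C_s`-compression of `A ⊆ [k+1]^(n+1)`: replace each slice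
`A_{s,t} = {y : t_s y ∈ A}` by the initial segment of the same size. -/
noncomputable def compress {k n : ℕ} (s : Fin (n + 1)) (A : Finset (Fin (n + 1) → Fin (k + 1))) :
    Finset (Fin (n + 1) → Fin (k + 1)) :=
  Finset.univ.biUnion fun t : Fin (k + 1) =>
    (initSeg k n
        (Finset.univ.filter fun y : Fin n → Fin (k + 1) => s.insertNth t y ∈ A).card).image
      fun y => s.insertNth t y

/-- `A` is compressed if every `C_s`-compression fixes it. -/
def IsCompressed {k n : ℕ} (A : Finset (Fin (n + 1) → Fin (k + 1))) : Prop :=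
  ∀ s : Fin (n + 1), compress s A = A

/-- `B_r`: points with exactly `r` zero coordinates. -/
noncomputable def Bexact (k N r : ℕ) : Finset (Fin N → Fin (k + 1)) :=
  Finset.univ.filter fun x => (rset x 0).card = r

/-- `B_{≥r}`: points with at least `r` zero coordinates. -/
noncomputable def Bge (k N r : ℕ) : Finset (Fin N → Fin (k + 1)) :=
  Finset.univ.filter fun x => r ≤ (rset x 0).card

/-- `m(x)`: the largest coordinate value of `x`. -/
noncomputable def mval {k N : ℕ} (x : Fin N → Fin (k + 1)) : ℕ :=
  Finset.univ.sup fun i => (x i : ℕ)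

/-- the class `C_X`: points with maximal coordinate `s`, attained exactly on `X`,
and exactly `r` zero coordinates. -/
noncomputable def classSet (k N s r : ℕ) (X : Finset (Fin N)) : Finset (Fin N → Fin (k + 1)) :=
  Finset.univ.filter fun x => mval x = s ∧ rset x s = X ∧ (rset x 0).card = r

/-- `[m]^N = {0,…,m−1}^N`. -/
noncomputable def box (k N m : ℕ) : Finset (Fin N → Fin (k + 1)) :=
  Finset.univ.filter fun x => ∀ i, (x i : ℕ) < m

/-- `{1,…,s−1}^N`. -/
noncomputable def box1 (k N s : ℕ) : Finset (Fin N → Fin (k + 1)) :=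
  Finset.univ.filter fun x => ∀ i, 1 ≤ (x i : ℕ) ∧ (x i : ℕ) ≤ s - 1

/-- `B` is a down-set. -/
def isDownSet {k N : ℕ} (B : Finset (Fin N → Fin (k + 1))) : Prop :=
  ∀ y ∈ B, ∀ x : Fin N → Fin (k + 1), (∀ j, (x j : ℕ) ≤ (y j : ℕ)) → x ∈ B

/-- `R_i(x)` for `ℕ`-valued sequences. -/
noncomputable def rsetN {n : ℕ} (x : Fin n → ℕ) (i : ℕ) : Finset (Fin n) :=
  Finset.univ.filter fun j => x j = i

/-- the strict `≤`-order on `ℕ_r^n`: `x < y` iff for the largest `i` with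
`R_i(x) ≠ R_i(y)` we have `max (R_i(x) Δ R_i(y)) ∈ R_i(y)`. -/
def pltN {n : ℕ} (x y : Fin n → ℕ) : Prop :=
  ∃ i : ℕ, binLT (rsetN x i) (rsetN y i) ∧ ∀ j : ℕ, i < j → rsetN x j = rsetN y j

/-- the `≤`-order on `ℕ_r^n`. -/
def pleN {n : ℕ} (x y : Fin n → ℕ) : Prop := x = y ∨ pltN x y

/-- the `d`-shadow for `ℕ`-valued sequences. -/
noncomputable def dShadowN {n : ℕ} (A : Finset (Fin n → ℕ)) : Finset (Fin n → ℕ) :=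
  A.biUnion fun x =>
    (Finset.univ.filter fun i => x i ≠ 0).image fun i => Function.update x i 0


namespace KK

/-- number of nonzero coordinates -/
noncomputable def rk {n : ℕ} (x : Fin n → ℕ) : ℕ := (Finset.univ.filter fun i => x i ≠ 0).card

/-- position of the coordinate `p` of `x` in the ground set -/
def el {n : ℕ} (x : Fin n → ℕ) (p : Fin n) : ℕ := (x p - 1) * n + p

noncomputable def E {n : ℕ} (x : Fin n → ℕ) : Finset ℕ :=
  (Finset.univ.filter fun i => x i ≠ 0).image (el x)

noncomputable def code {n : ℕ} (x : Fin n → ℕ) : ℕ := ∑ e ∈ E x, 2 ^ e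

lemma enc_lt_iff {n a b p q : ℕ} (hp : p < n) (hq : q < n) :
    a * n + p < b * n + q ↔ a < b ∨ (a = b ∧ p < q) := by
  constructor
  · intro h
    rcases lt_trichotomy a b with h1 | h1 | h1
    · exact Or.inl h1
    · subst h1; right; exact ⟨rfl, by omega⟩
    · exfalso
      have : (b + 1) * n ≤ a * n := Nat.mul_le_mul_right n h1
      rw [add_mul] at this
      omega
  · rintro (h | ⟨rfl, h⟩)
    · have : (a + 1) * n ≤ b * n := Nat.mul_le_mul_right n h
      rw [add_mul] at this
      omega
    · omega

lemma el_lt_iff {n : ℕ} {x y : Fin n → ℕ} {p q : Fin n} (hx : x p ≠ 0) (hy : y q ≠ 0) :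
    el x p < el y q ↔ x p < y q ∨ (x p = y q ∧ p < q) := by
  unfold el
  rw [enc_lt_iff p.2 q.2, Fin.lt_def]
  omega

lemma el_inj {n : ℕ} {x y : Fin n → ℕ} {p q : Fin n} (hx : x p ≠ 0) (hy : y q ≠ 0)
    (h : el x p = el y q) : p = q ∧ x p = y q := by
  have h1 := el_lt_iff hx hy
  have h2 := el_lt_iff hy hx
  rw [h] at h1
  rw [h] at h2
  simp only [lt_irrefl, false_iff, not_or, not_and, not_lt] at h1 h2
  have : x p = y q := by omega
  exact ⟨le_antisymm (h2.2 this.symm) (h1.2 this), this⟩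

lemma mem_E {n : ℕ} {x : Fin n → ℕ} {e : ℕ} : e ∈ E x ↔ ∃ p, x p ≠ 0 ∧ el x p = e := by
  simp [E]

lemma el_mem_E {n : ℕ} {x y : Fin n → ℕ} {p : Fin n} (hp : y p ≠ 0) :
    el y p ∈ E x ↔ x p = y p := by
  rw [mem_E]
  constructor
  · rintro ⟨q, hq, h⟩
    obtain ⟨rfl, h⟩ := el_inj hq hp h
    exact h
  · intro h
    exact ⟨p, by rwa [h], by simp [el, h]⟩

lemma card_E {n : ℕ} (x : Fin n → ℕ) : (E x).card = rk x := by
  unfold E rk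
  apply Finset.card_image_of_injOn
  intro p hp q hq h
  simp only [Finset.coe_filter, Finset.mem_univ, true_and, Set.mem_ofPred_eq] at hp hq
  exact (el_inj hp hq h).1

lemma E_inj {n : ℕ} {x y : Fin n → ℕ} (h : E x = E y) : x = y := by
  funext p
  by_cases hx : x p = 0
  · by_contra hne
    have hy : y p ≠ 0 := by omega
    have : el y p ∈ E x := by rw [h]; exact mem_E.2 ⟨p, hy, rfl⟩
    exact hne ((el_mem_E hy).1 this)
  · have : el x p ∈ E y := by rw [← h]; exact mem_E.2 ⟨p, hx, rfl⟩
    exact ((el_mem_E hx).1 this).symm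

lemma code_inj {n : ℕ} {x y : Fin n → ℕ} (h : code x = code y) : x = y :=
  E_inj (Finset.geomSum_injective le_rfl h)

lemma code_lt_iff {n : ℕ} {x y : Fin n → ℕ} :
    code x < code y ↔
      ∃ p, y p ≠ 0 ∧ x p ≠ y p ∧ ∀ q, x q ≠ 0 → x q ≠ y q → el x q < el y p := by
  unfold code
  rw [Finset.geomSum_lt_geomSum_iff_toColex_lt_toColex le_rfl,
    Finset.Colex.toColex_lt_toColex_iff_exists_forall_lt]
  constructor
  · rintro ⟨a, ha, hax, h⟩
    obtain ⟨p, hp, rfl⟩ := mem_E.1 ha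
    refine ⟨p, hp, fun h => hax ((el_mem_E hp).2 h), fun q hq hne => ?_⟩
    refine h _ (mem_E.2 ⟨q, hq, rfl⟩) fun h => hne ((el_mem_E hq).1 h).symm
  · rintro ⟨p, hp, hne, h⟩
    refine ⟨el y p, mem_E.2 ⟨p, hp, rfl⟩, fun h => hne ((el_mem_E hp).1 h), ?_⟩
    intro b hb hb'
    obtain ⟨q, hq, rfl⟩ := mem_E.1 hb
    exact h q hq fun h => hb' ((el_mem_E hq).2 h.symm)

lemma code_lt_pow {n : ℕ} {x : Fin n → ℕ} {c : ℕ} :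
    code x < 2 ^ c ↔ ∀ e ∈ E x, e < c := by
  constructor
  · intro h e he
    have : 2 ^ e ≤ code x := Finset.single_le_sum (f := fun e => 2 ^ e) (fun _ _ => by positivity) he
    exact (Nat.pow_lt_pow_iff_right (by norm_num)).1 (lt_of_le_of_lt this h)
  · exact fun h => Nat.geomSum_lt le_rfl h

/-- the order of the frozen statement contains the code order -/
lemma pltN_of_code_lt {n : ℕ} {x y : Fin n → ℕ} (h : code x < code y) : pltN x y := by
  rw [code_lt_iff] at h
  obtain ⟨p0, hp0, hne0, h0⟩ := h
  obtain ⟨p, hp, hmax⟩ := Finset.exists_max_image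
    (Finset.univ.filter fun p => y p ≠ 0 ∧ x p ≠ y p) (el y) ⟨p0, by simp [hp0, hne0]⟩
  simp only [Finset.mem_filter, Finset.mem_univ, true_and] at hp hmax
  have hx : ∀ q, x q ≠ 0 → x q ≠ y q → el x q < el y p := fun q h1 h2 =>
    lt_of_lt_of_le (h0 q h1 h2) (hmax p0 ⟨hp0, hne0⟩)
  refine ⟨y p, ⟨p, by simp [rsetN], by simpa [rsetN] using hp.2, ?_⟩, ?_⟩
  · intro j hj
    simp only [rsetN, Finset.mem_filter, Finset.mem_univ, true_and] at hj
    rcases hj with ⟨h1, h2⟩ | ⟨h1, h2⟩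
    · have h3 : x j ≠ 0 := by rw [h1]; exact hp.1
      have := hx j h3 (by rw [h1]; exact fun h => h2 h.symm)
      rw [el_lt_iff h3 hp.1] at this
      rcases this with h | h
      · omega
      · exact h.2.le
    · have h3 : y j ≠ 0 := by rw [h1]; exact hp.1
      have := hmax j ⟨h3, by rw [h1]; exact h2⟩
      by_contra hlt
      rw [not_le] at hlt
      have := (el_lt_iff hp.1 h3).2 (Or.inr ⟨h1.symm, hlt⟩)
      omega
  · intro i hi
    ext q
    simp only [rsetN, Finset.mem_filter, Finset.mem_univ, true_and]
    constructor
    · intro h1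
      by_contra h2
      have h3 : x q ≠ 0 := by omega
      have := hx q h3 (by omega)
      rw [el_lt_iff h3 hp.1] at this
      omega
    · intro h1
      by_contra h2
      have h3 : y q ≠ 0 := by omega
      have := hmax q ⟨h3, by omega⟩
      have := (el_lt_iff hp.1 h3).2 (Or.inl (by omega))
      omega

/-! ### initial segments -/

def IsInit {n : ℕ} (r : ℕ) (C : Finset (Fin n → ℕ)) : Prop :=
  (∀ x ∈ C, rk x = r) ∧ ∀ y ∈ C, ∀ x, rk x = r → code x < code y → x ∈ C

lemma finite_code {n : ℕ} (N : ℕ) : {x : Fin n → ℕ | code x < N}.Finite := by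
  apply Set.Finite.of_finite_image (f := code)
  · exact (Set.finite_lt_nat N).subset (by rintro _ ⟨x, hx, rfl⟩; exact hx)
  · intro x _ y _ h
    exact code_inj h

lemma IsInit.total {n r : ℕ} {C D : Finset (Fin n → ℕ)} (hC : IsInit r C) (hD : IsInit r D) :
    C ⊆ D ∨ D ⊆ C := by
  by_contra h
  rw [not_or] at h
  obtain ⟨h1, h2⟩ := h
  obtain ⟨x, hx, hxD⟩ := Finset.not_subset.1 h1
  obtain ⟨y, hy, hyC⟩ := Finset.not_subset.1 h2
  rcases lt_trichotomy (code x) (code y) with h | h | h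
  · exact hxD (hD.2 y hy x (hC.1 x hx) h)
  · rw [code_inj h] at hx; exact hyC hx
  · exact hyC (hC.2 x hx y (hD.1 y hy) h)

lemma IsInit.subset_of_card {n r : ℕ} {C D : Finset (Fin n → ℕ)} (hC : IsInit r C)
    (hD : IsInit r D) (h : C.card ≤ D.card) : C ⊆ D := by
  rcases hC.total hD with h1 | h1
  · exact h1
  · rw [Finset.eq_of_subset_of_card_le h1 h]

lemma IsInit.eq_of_card {n r : ℕ} {C D : Finset (Fin n → ℕ)} (hC : IsInit r C)
    (hD : IsInit r D) (h : C.card = D.card) : C = D :=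
  Finset.Subset.antisymm (hC.subset_of_card hD h.le) (hD.subset_of_card hC h.ge)

lemma isInit_empty {n r : ℕ} : IsInit r (∅ : Finset (Fin n → ℕ)) := by
  simp [IsInit]

lemma exists_init {n r : ℕ} (S : Finset (Fin n → ℕ)) (hS : ∀ x ∈ S, rk x = r) (a : ℕ)
    (ha : a ≤ S.card) : ∃ I : Finset (Fin n → ℕ), IsInit r I ∧ I.card = a := by
  induction a with
  | zero => exact ⟨∅, isInit_empty, rfl⟩
  | succ a ih =>
    obtain ⟨I, hI, hc⟩ := ih (by omega)
    have hne : (S \ I).Nonempty := by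
      rw [Finset.sdiff_nonempty]
      intro h
      have := Finset.card_le_card h
      omega
    obtain ⟨y, hy⟩ := hne
    rw [Finset.mem_sdiff] at hy
    have hex : ∃ k, ∃ x : Fin n → ℕ, rk x = r ∧ x ∉ I ∧ code x = k := ⟨_, y, hS y hy.1, hy.2, rfl⟩
    classical
    obtain ⟨x, hx1, hx2, hx3⟩ := Nat.find_spec hex
    have hmin : ∀ z : Fin n → ℕ, rk z = r → code z < code x → z ∈ I := by
      intro z hz hlt
      by_contra hzI
      rw [hx3] at hlt
      exact Nat.find_min hex hlt ⟨z, hz, hzI, rfl⟩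
    refine ⟨insert x I, ⟨?_, ?_⟩, by rw [Finset.card_insert_of_notMem hx2, hc]⟩
    · intro z hz
      rcases Finset.mem_insert.1 hz with rfl | hz
      · exact hx1
      · exact hI.1 z hz
    · intro w hw z hz hlt
      rw [Finset.mem_insert] at hw ⊢
      right
      rcases hw with rfl | hw
      · exact hmin z hz hlt
      · exact hI.2 w hw z hz hlt

noncomputable def Iseg (n r a : ℕ) : Finset (Fin n → ℕ) :=
  if h : ∃ I : Finset (Fin n → ℕ), IsInit r I ∧ I.card = a then h.choose else ∅

lemma Iseg_isInit (n r a : ℕ) : IsInit r (Iseg n r a) := by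
  unfold Iseg
  split_ifs with h
  · exact h.choose_spec.1
  · exact isInit_empty

lemma Iseg_card {n r a : ℕ} (S : Finset (Fin n → ℕ)) (hS : ∀ x ∈ S, rk x = r)
    (ha : a ≤ S.card) : (Iseg n r a).card = a := by
  unfold Iseg
  have h := exists_init S hS a ha
  rw [dif_pos h]
  exact h.choose_spec.2

/-- shadow size of the initial segment of size `a` -/
noncomputable def F (n r a : ℕ) : ℕ := (dShadowN (Iseg n r a)).card

lemma F_eq {n r a : ℕ} {C : Finset (Fin n → ℕ)} (hC : IsInit r C) (ha : C.card = a) :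
    (dShadowN C).card = F n r a := by
  unfold F
  rw [(Iseg_isInit n r a).eq_of_card hC]
  rw [Iseg_card C hC.1 ha.ge, ha]

lemma F_zero (n r : ℕ) : F n r 0 = 0 := by
  rw [← F_eq (C := ∅) (a := 0) isInit_empty (by simp)]
  simp [dShadowN]

/-- all points of rank `r` with all elements `< c` -/
noncomputable def T (n r c : ℕ) : Finset (Fin n → ℕ) :=
  (finite_code (n := n) (2 ^ c)).toFinset.filter fun x => rk x = r

lemma mem_T {n r c : ℕ} {x : Fin n → ℕ} : x ∈ T n r c ↔ rk x = r ∧ ∀ e ∈ E x, e < c := by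
  simp [T, code_lt_pow, and_comm]

lemma T_isInit (n r c : ℕ) : IsInit r (T n r c) := by
  refine ⟨fun x hx => (mem_T.1 hx).1, fun y hy x hx hlt => ?_⟩
  rw [mem_T, ← code_lt_pow] at hy ⊢
  exact ⟨hx, hlt.trans hy.2⟩

lemma T_mono {n r c c' : ℕ} (h : c ≤ c') : T n r c ⊆ T n r c' := by
  intro x hx
  rw [mem_T] at hx ⊢
  exact ⟨hx.1, fun e he => lt_of_lt_of_le (hx.2 e he) h⟩

lemma mem_d {n : ℕ} {A : Finset (Fin n → ℕ)} {w : Fin n → ℕ} :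
    w ∈ dShadowN A ↔ ∃ x ∈ A, ∃ i, x i ≠ 0 ∧ w = Function.update x i 0 := by
  simp only [dShadowN, Finset.mem_biUnion, Finset.mem_image, Finset.mem_filter, Finset.mem_univ,
    true_and]
  constructor
  · rintro ⟨x, hx, i, hi, rfl⟩; exact ⟨x, hx, i, hi, rfl⟩
  · rintro ⟨x, hx, i, hi, rfl⟩; exact ⟨x, hx, i, hi, rfl⟩

lemma d_mono {n : ℕ} {A B : Finset (Fin n → ℕ)} (h : A ⊆ B) : dShadowN A ⊆ dShadowN B := by
  intro w hw
  rw [mem_d] at hw ⊢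
  obtain ⟨x, hx, h'⟩ := hw
  exact ⟨x, h hx, h'⟩

lemma rk_update_zero {n : ℕ} {x : Fin n → ℕ} {i : Fin n} (hi : x i ≠ 0) :
    rk (Function.update x i 0) + 1 = rk x := by
  unfold rk
  have : (Finset.univ.filter fun j => Function.update x i 0 j ≠ 0)
      = (Finset.univ.filter fun j => x j ≠ 0).erase i := by
    ext j
    by_cases h : j = i
    · subst h; simp
    · simp [h]
  rw [this, Finset.card_erase_add_one (by simp [hi])]

lemma rk_update_nonzero {n : ℕ} {x : Fin n → ℕ} {i : Fin n} {v : ℕ} (hi : x i = 0) (hv : v ≠ 0) :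
    rk (Function.update x i v) = rk x + 1 := by
  have h := rk_update_zero (x := Function.update x i v) (i := i) (by simpa)
  rw [Function.update_idem, ← hi, Function.update_eq_self] at h
  exact h.symm

lemma rk_update_same {n : ℕ} {x : Fin n → ℕ} {i : Fin n} {v : ℕ} (hi : x i ≠ 0) (hv : v ≠ 0) :
    rk (Function.update x i v) = rk x := by
  have h := rk_update_zero (x := Function.update x i v) (i := i) (by simpa)
  rw [Function.update_idem] at h
  rw [← h, rk_update_zero hi]

lemma rk_d {n r : ℕ} {A : Finset (Fin n → ℕ)} (hA : ∀ x ∈ A, rk x = r + 1) :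
    ∀ w ∈ dShadowN A, rk w = r := by
  intro w hw
  obtain ⟨x, hx, i, hi, rfl⟩ := mem_d.1 hw
  have := rk_update_zero hi
  have := hA x hx
  omega

lemma exists_zero {n : ℕ} {x : Fin n → ℕ} (h : rk x < n) : ∃ p, x p = 0 := by
  by_contra hne
  push Not at hne
  unfold rk at h
  rw [Finset.filter_true_of_mem (by simpa using hne)] at h
  simp at h

lemma exists_nonzero {n : ℕ} {x : Fin n → ℕ} (h : 0 < rk x) : ∃ p, x p ≠ 0 := by
  unfold rk at h
  obtain ⟨p, hp⟩ := Finset.card_pos.1 h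
  exact ⟨p, by simpa using hp⟩

lemma rk_le {n : ℕ} (x : Fin n → ℕ) : rk x ≤ n := by
  unfold rk
  simpa using Finset.card_filter_le (Finset.univ : Finset (Fin n)) fun i => x i ≠ 0

end KK

namespace KK

def Good (f : ℕ → ℕ) (l : ℕ) : Prop :=
  ∀ a b, a ≤ l → b ≤ l → (a + b ≤ l → f (a + b) ≤ f a + f b) ∧
    (l ≤ a + b → f l + f (a + b - l) ≤ f a + f b)

lemma Good.push {f : ℕ → ℕ} (f0 : f 0 = 0) {l a b : ℕ} (h : Good f l) (ha : a < l) (hb : b ≤ l)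
    (hb0 : 0 < b) : ∃ δ, 0 < δ ∧ δ ≤ b ∧ a + δ ≤ l ∧ f (a + δ) + f (b - δ) ≤ f a + f b := by
  rcases le_total (a + b) l with h1 | h1
  · refine ⟨b, hb0, le_rfl, h1, ?_⟩
    have := (h a b ha.le hb).1 h1
    simpa [f0] using this
  · refine ⟨l - a, by omega, by omega, by omega, ?_⟩
    have := (h a b ha.le hb).2 h1
    have e1 : a + (l - a) = l := by omega
    have e2 : b - (l - a) = a + b - l := by omega
    rw [e1, e2]; exact this

def Sm (l : ℕ → ℕ) (i : ℕ) : ℕ := ∑ j ∈ Finset.range i, l j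

lemma Sm_succ (l : ℕ → ℕ) (i : ℕ) : Sm l (i + 1) = Sm l i + l i := Finset.sum_range_succ _ _

def Spec (f l h : ℕ → ℕ) : Prop :=
  ∀ i t, t ≤ l i → h (Sm l i + t) = ∑ j ∈ Finset.range i, f (l j) + f t

lemma numA {f l h : ℕ → ℕ} (f0 : f 0 = 0) (hl : ∀ i, Good f (l i)) (hs : Spec f l h) (K : ℕ) :
    ∀ a : ℕ → ℕ, (∀ i < K, a i ≤ l i) → (∀ i j, i < j → j < K → a i < l i → a j ≤ l i) →
      h (∑ i ∈ Finset.range K, a i) ≤ ∑ i ∈ Finset.range K, f (a i) := by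
  induction K with
  | zero =>
    intro a _ _
    have := hs 0 0 (by omega)
    simp [Sm, f0] at this
    simp [this]
  | succ K ih =>
    suffices H : ∀ b, ∀ a : ℕ → ℕ, a K = b → (∀ i < K + 1, a i ≤ l i) →
      (∀ i j, i < j → j < K + 1 → a i < l i → a j ≤ l i) →
      h (∑ i ∈ Finset.range (K + 1), a i) ≤ ∑ i ∈ Finset.range (K + 1), f (a i) from
      fun a h1 h2 => H _ a rfl h1 h2
    intro b
    induction b using Nat.strong_induction_on with
    | _ b ihb =>
    intro a hab h1 h2
    by_cases hb0 : b = 0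
    · rw [Finset.sum_range_succ, Finset.sum_range_succ, hab, hb0, f0]
      simpa using ih a (fun i hi => h1 i (by omega)) (fun i j hij hj => h2 i j hij (by omega))
    by_cases hfull : ∀ i < K, a i = l i
    · have e1 : ∑ i ∈ Finset.range K, a i = Sm l K :=
        Finset.sum_congr rfl fun i hi => hfull i (Finset.mem_range.1 hi)
      have e2 : ∑ i ∈ Finset.range K, f (a i) = ∑ i ∈ Finset.range K, f (l i) :=
        Finset.sum_congr rfl fun i hi => by rw [hfull i (Finset.mem_range.1 hi)]
      rw [Finset.sum_range_succ, Finset.sum_range_succ, e1, e2]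
      exact (hs K (a K) (h1 K (by omega))).le
    · push Not at hfull
      classical
      set i := Nat.find hfull with hi
      obtain ⟨hiK, hil⟩ := Nat.find_spec hfull
      rw [← hi] at hiK hil
      have hlow : ∀ j < i, a j = l j := by
        intro j hj
        by_contra hne
        exact Nat.find_min hfull hj ⟨by omega, hne⟩
      have hlt : a i < l i := lt_of_le_of_ne (h1 i (by omega)) hil
      obtain ⟨δ, hδ0, hδb, hδl, hf⟩ := (hl i).push f0 hlt (h2 i K hiK (by omega) hlt)
        (by omega : 0 < a K)
      let a' : ℕ → ℕ := fun j => if j = i then a i + δ else if j = K then a K - δ else a j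
      have ai : a' i = a i + δ := by simp [a']
      have aK : a' K = a K - δ := by simp [a', (show K ≠ i by omega)]
      have ao : ∀ j, j ≠ i → j ≠ K → a' j = a j := fun j h1 h2 => by simp [a', h1, h2]
      have key := ihb (a K - δ) (by omega) a' aK ?_ ?_
      · have hsum : ∀ g : ℕ → ℕ, ∑ j ∈ Finset.range (K + 1), g j =
            ∑ j ∈ (Finset.range K).erase i, g j + g i + g K := by
          intro g
          rw [Finset.sum_range_succ, Finset.sum_erase_add _ _ (Finset.mem_range.2 hiK)]
        have hcong : ∀ j ∈ (Finset.range K).erase i, a' j = a j := by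
          intro j hj
          rw [Finset.mem_erase, Finset.mem_range] at hj
          exact ao j hj.1 (by omega)
        have hcong2 : ∑ j ∈ (Finset.range K).erase i, f (a' j)
            = ∑ j ∈ (Finset.range K).erase i, f (a j) :=
          Finset.sum_congr rfl (fun j hj => by rw [hcong j hj])
        rw [hsum, hsum, Finset.sum_congr rfl hcong, hcong2, ai, aK] at key
        rw [hsum, hsum]
        have e : ∑ x ∈ (Finset.range K).erase i, a x + (a i + δ) + (a K - δ)
          = ∑ x ∈ (Finset.range K).erase i, a x + a i + a K := by omega
        rw [e] at key
        omega
      · intro j hj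
        by_cases e1 : j = i
        · rw [e1, ai]; exact hδl
        by_cases e2 : j = K
        · rw [e2, aK]; have := h1 K (by omega); omega
        rw [ao j e1 e2]; exact h1 j hj
      · intro j k hjk hk hlt'
        by_cases e1 : j = i
        · have : a' k ≤ a k := by
            by_cases e2 : k = K
            · rw [e2, aK]; omega
            · rw [ao k (by omega) e2]
          rw [e1]
          exact this.trans (h2 i k (by omega) hk hlt)
        have e2 : j ≠ K := by omega
        rw [ao j e1 e2] at hlt'
        have e3 : ¬ j < i := fun h => by rw [hlow j h] at hlt'; omega
        have : a' k ≤ a k := by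
            by_cases e2 : k = K
            · rw [e2, aK]; omega
            · rw [ao k (by omega) e2]
        exact this.trans (h2 j k hjk hk hlt')

lemma dec_low {l : ℕ → ℕ} (K b : ℕ) (h : b < Sm l K) : ∃ j < K, Sm l j ≤ b ∧ b < Sm l (j + 1) := by
  induction K with
  | zero => simp [Sm] at h
  | succ K ih =>
    by_cases h1 : b < Sm l K
    · obtain ⟨j, hj, h2⟩ := ih h1
      exact ⟨j, by omega, h2⟩
    · exact ⟨K, by omega, by omega, h⟩

lemma Sm_mono (l : ℕ → ℕ) : Monotone (Sm l) := by
  apply monotone_nat_of_le_succ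
  intro i
  rw [Sm_succ]; omega

lemma numB {f l h : ℕ → ℕ} (f0 : f 0 = 0) (hl : ∀ i, Good f (l i)) (hm : Monotone l)
    (hs : Spec f l h) (K : ℕ) :
    ∀ d a b, a ≤ b → b + d = Sm l K → Sm l K ≤ a + b →
      h (Sm l K) + h (a + b - Sm l K) ≤ h a + h b := by
  intro d
  induction d using Nat.strong_induction_on with
  | _ d ih =>
  intro a b hab hd hge
  by_cases hd0 : d = 0
  · have e1 : b = Sm l K := by omega
    have e2 : a + b - Sm l K = a := by omega
    rw [e2, e1]; omega
  obtain ⟨j, hj, hj1, hj2⟩ := dec_low (l := l) K b (by omega)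
  obtain ⟨i, hi, hi1, hi2⟩ := dec_low (l := l) K (a - 1) (by omega)
  have hij : i ≤ j := by
    by_contra hlt
    have := Sm_mono l (show j + 1 ≤ i by omega)
    omega
  have hlij := hm hij
  rw [Sm_succ] at hi2 hj2
  obtain ⟨t, ht⟩ := Nat.exists_eq_add_of_le (show Sm l i ≤ a by omega)
  obtain ⟨t', ht'⟩ := Nat.exists_eq_add_of_le hj1
  obtain ⟨δ, h0, h1, h2, h3⟩ := (hl j).push f0 (show t' < l j by omega) (show t ≤ l j by omega)
    (show 0 < t by omega)
  have key := ih (d - δ) (by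
    have := Sm_mono l (show j + 1 ≤ K by omega)
    rw [Sm_succ] at this
    omega) (a - δ) (b + δ) (by omega) (by
    have := Sm_mono l (show j + 1 ≤ K by omega)
    rw [Sm_succ] at this
    omega) (by omega)
  rw [show a - δ + (b + δ) - Sm l K = a + b - Sm l K by omega] at key
  have s1 := hs i t (by omega)
  have s2 := hs i (t - δ) (by omega)
  have s3 := hs j t' (by omega)
  have s4 := hs j (t' + δ) (by omega)
  rw [show Sm l i + (t - δ) = a - δ by omega] at s2
  rw [show Sm l j + (t' + δ) = b + δ by omega] at s4
  rw [← ht] at s1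
  rw [← ht'] at s3
  omega

def ind (N : ℕ) : ℕ := if N = 0 then 0 else 1

def SpecI (f l F : ℕ → ℕ) : Prop :=
  ∀ i t, t ≤ l i → F (Sm l i + t) = ∑ j ∈ Finset.range i, f (l j) + f t + ind (Sm l i + t)

lemma SpecI.spec {f l F : ℕ → ℕ} (h : SpecI f l F) : Spec f l (fun N => F N - ind N) := by
  intro i t ht
  have := h i t ht
  simp only
  omega

lemma SpecI.dec {f l F : ℕ → ℕ} (h : SpecI f l F) {K N : ℕ} (hN : N ≤ Sm l K) : ind N ≤ F N := by
  rcases hN.lt_or_eq with h1 | h1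
  · obtain ⟨j, hj, h2, h3⟩ := dec_low K N h1
    rw [Sm_succ] at h3
    have := h j (N - Sm l j) (by omega)
    rw [show Sm l j + (N - Sm l j) = N by omega] at this
    omega
  · have := h K 0 (by omega)
    rw [show Sm l K + 0 = N by omega] at this
    omega

lemma numA' {f l F : ℕ → ℕ} (f0 : f 0 = 0) (hl : ∀ i, Good f (l i)) (hs : SpecI f l F) (K : ℕ)
    (a : ℕ → ℕ) (h1 : ∀ i < K, a i ≤ l i) (h2 : ∀ i j, i < j → j < K → a i < l i → a j ≤ l i) :
      F (∑ i ∈ Finset.range K, a i) ≤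
        ∑ i ∈ Finset.range K, f (a i) + ind (∑ i ∈ Finset.range K, a i) := by
  have := numA f0 hl hs.spec K a h1 h2
  omega

lemma numB' {f l F : ℕ → ℕ} (f0 : f 0 = 0) (hl : ∀ i, Good f (l i)) (hm : Monotone l)
    (hs : SpecI f l F) (K a b : ℕ) (ha : a ≤ Sm l K) (hb : b ≤ Sm l K) (hab : Sm l K ≤ a + b) :
      F (Sm l K) + F (a + b - Sm l K) ≤ F a + F b := by
  wlog hle : a ≤ b generalizing a b with H
  · have := H b a hb ha (by omega) (by omega)
    rw [add_comm b a] at this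
    omega
  have key := numB f0 hl hm hs.spec K (Sm l K - b) a b hle (by omega) hab
  have d1 := hs.dec ha
  have d2 := hs.dec hb
  have d3 := hs.dec (le_refl (Sm l K))
  have d4 := hs.dec (show a + b - Sm l K ≤ Sm l K by omega)
  have : ind (Sm l K) + ind (a + b - Sm l K) ≤ ind a + ind b := by
    unfold ind
    split_ifs <;> omega
  omega

end KK

namespace KK

lemma exists_first_zero {n : ℕ} {w : Fin n → ℕ} (h : rk w < n) :
    ∃ q, w q = 0 ∧ ∀ i < q, w i ≠ 0 := by
  obtain ⟨p, hp⟩ := exists_zero h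
  obtain ⟨q, hq, hmin⟩ := Finset.exists_min_image (Finset.univ.filter fun i => w i = 0) id
    ⟨p, by simp [hp]⟩
  simp only [Finset.mem_filter, Finset.mem_univ, true_and, id] at hq hmin
  exact ⟨q, hq, fun i hi h => absurd (hmin i h) (not_le.2 hi)⟩

lemma up_le_self {n : ℕ} {w : Fin n → ℕ} {q p : Fin n} {b : ℕ} (hq : w q = 0)
    (hfirst : ∀ i < q, w i ≠ 0) (hp : w p = 0) (hb : b ≠ 0) :
    code (Function.update w q 1) ≤ code (Function.update w p b) := by
  by_cases heq : q = p ∧ b = 1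
  · rw [heq.1, heq.2]
  apply le_of_lt
  have hqp : q ≤ p := by
    by_contra hlt
    exact hfirst p (not_le.1 hlt) hp
  rw [code_lt_iff]
  refine ⟨p, by simpa, ?_, ?_⟩
  · by_cases h : p = q
    · subst h; simp; tauto
    · simp [h, hp]; omega
  · intro i hi hne
    have hiq : i = q := by
      by_contra hiq
      by_cases hip : i = p
      · subst hip; simp [hiq, hp] at hi
      · simp [hiq, hip] at hne
    subst hiq
    rw [el_lt_iff hi (by simpa)]
    simp only [Function.update_self]
    by_cases h : i = p
    · have : b ≠ 1 := fun h' => heq ⟨h, h'⟩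
      omega
    · have := lt_of_le_of_ne hqp h
      by_cases hb1 : b = 1
      · right; exact ⟨hb1.symm, this⟩
      · left; omega

lemma up_le {n : ℕ} {w' w : Fin n → ℕ} {q' q : Fin n} {b : ℕ} (hrk : rk w' = rk w)
    (hlt : code w' < code w) (hq' : w' q' = 0)
    (hfirst : ∀ i < q', w' i ≠ 0) (hq : w q = 0) (hb : b ≠ 0) :
    code (Function.update w' q' 1) ≤ code (Function.update w q b) := by
  obtain ⟨p0, hp0, hne0, h0⟩ := code_lt_iff.1 hlt
  have hp0q : p0 ≠ q := fun h => hp0 (by rw [h, hq])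
  by_cases hcase : 1 < w p0 ∨ (1 = w p0 ∧ q' < p0)
  · apply le_of_lt
    rw [code_lt_iff]
    have helz : el (Function.update w q b) p0 = el w p0 := by simp [el, hp0q]
    refine ⟨p0, by simpa [hp0q], ?_, ?_⟩
    · by_cases h : p0 = q'
      · subst h
        simp only [Function.update_self, Function.update_of_ne hp0q]
        intro h
        rcases hcase with h1 | h1
        · omega
        · exact lt_irrefl _ h1.2
      · simpa [h, hp0q] using hne0
    · intro i hi hne
      rw [helz]
      by_cases hiq' : i = q'
      · subst hiq'
        rw [el_lt_iff hi hp0]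
        simpa using hcase
      · have e : el (Function.update w' q' 1) i = el w' i := by simp [el, hiq']
        rw [Function.update_of_ne hiq'] at hi hne
        rw [e]
        apply h0 i hi
        by_cases hiq : i = q
        · rw [hiq, hq, ← hiq]; exact hi
        · rwa [Function.update_of_ne hiq] at hne
  · rw [not_or, not_lt] at hcase
    have hw1 : w p0 = 1 := by omega
    have hpq : p0 ≤ q' := by
      by_contra h
      exact hcase.2 ⟨hw1.symm, not_le.1 h⟩
    have hw' : w' p0 = 0 := by
      by_contra h
      have := h0 p0 h hne0
      rw [el_lt_iff h hp0] at this
      rcases this with h1 | h1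
      · omega
      · exact lt_irrefl _ h1.2
    have hq'p : q' = p0 := by
      rcases hpq.lt_or_eq with h | h
      · exact absurd hw' (hfirst p0 h)
      · exact h.symm
    subst hq'p
    by_contra hcon
    rw [not_le, code_lt_iff] at hcon
    obtain ⟨p, hp, hne, h1⟩ := hcon
    have hpp0 : p ≠ q' := by
      rintro rfl
      simp [hp0q, hw1] at hne
    rw [Function.update_of_ne hpp0] at hp hne
    have e1 : el (Function.update w' q' 1) p = el w' p := by simp [el, hpp0]
    rw [e1] at h1
    have small : ∀ i, w' i ≠ 0 → w' i ≠ w i → w' i = 1 ∧ i < q' := by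
      intro i hi hne
      have := h0 i hi hne
      rw [el_lt_iff hi hp0, hw1] at this
      omega
    have hps : w' p = 1 ∧ p < q' := by
      apply small p hp
      by_cases h : p = q
      · rw [h, hq, ← h]; exact hp
      · rw [Function.update_of_ne h] at hne; exact fun h => hne h.symm
    have hsub : ∀ i, Function.update w q b i ≠ 0 →
        Function.update w q b i = Function.update w' q' 1 i := by
      intro i hi
      by_contra hne'
      have := h1 i hi hne'
      rw [el_lt_iff hi hp, hps.1] at this
      have hz1 : Function.update w q b i = 1 ∧ i < p := by omega
      have hiq' : i < q' := hz1.2.trans hps.2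
      rw [Function.update_of_ne hiq'.ne, hz1.1] at hne'
      have hwi := hfirst i hiq'
      have : w' i ≠ w i := by
        by_cases h : i = q
        · rw [h, hq, ← h]; exact hwi
        · rw [Function.update_of_ne h] at hz1; rw [hz1.1]; exact fun h => hne' h.symm
      exact hne' (small i hwi this).1.symm
    have hr : rk (Function.update w q b) < rk (Function.update w' q' 1) := by
      unfold rk
      apply Finset.card_lt_card
      rw [Finset.ssubset_iff_of_subset]
      · refine ⟨p, by simp [hpp0, hp], ?_⟩
        simp only [Finset.mem_filter, Finset.mem_univ, true_and, not_not]
        by_contra h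
        have := hsub p h
        rw [Function.update_of_ne hpp0] at this
        exact hne this
      · intro i hi
        simp only [Finset.mem_filter, Finset.mem_univ, true_and] at hi ⊢
        rw [← hsub i hi]; exact hi
    rw [rk_update_nonzero hq hb, rk_update_nonzero hq' (by norm_num)] at hr
    omega

lemma mem_of_code_le {n r : ℕ} {C : Finset (Fin n → ℕ)} (hC : IsInit r C) {x y : Fin n → ℕ}
    (hy : y ∈ C) (hx : rk x = r) (h : code x ≤ code y) : x ∈ C := by
  rcases h.lt_or_eq with h | h
  · exact hC.2 y hy x hx h
  · rw [code_inj h]; exact hy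

lemma up_mem {n r : ℕ} {C : Finset (Fin n → ℕ)} (hC : IsInit (r + 1) C) {w : Fin n → ℕ}
    (hw : w ∈ dShadowN C) {q : Fin n} (hq : w q = 0) (hfirst : ∀ i < q, w i ≠ 0) :
    Function.update w q 1 ∈ C := by
  have hrw := rk_d hC.1 w hw
  obtain ⟨z, hz, p, hp, rfl⟩ := mem_d.1 hw
  apply mem_of_code_le hC hz
  · rw [rk_update_nonzero hq (by norm_num), hrw]
  · have := up_le_self hq hfirst (p := p) (b := z p) (by simp) hp
    simpa using this

lemma IsInit.d {n r : ℕ} {C : Finset (Fin n → ℕ)} (hC : IsInit (r + 1) C) :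
    IsInit r (dShadowN C) := by
  refine ⟨rk_d hC.1, ?_⟩
  intro w hw w' hrw' hlt
  have hrw := rk_d hC.1 w hw
  obtain ⟨z, hz, p, hp, rfl⟩ := mem_d.1 hw
  have h1 := hC.1 z hz
  have h2 := rk_le z
  obtain ⟨q, hq, hfirst⟩ := exists_first_zero (show rk w' < n by omega)
  rw [mem_d]
  refine ⟨Function.update w' q 1, ?_, q, by simp, ?_⟩
  · apply mem_of_code_le hC hz
    · rw [rk_update_nonzero hq (by norm_num), hrw']
    · have := up_le (hrw'.trans hrw.symm) hlt hq hfirst (q := p) (b := z p) (by simp) hp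
      simpa using this
  · rw [Function.update_idem, ← hq, Function.update_eq_self]

/-! ### insertion of a coordinate -/

def ins {n : ℕ} (j : Fin (n + 1)) (v : ℕ) (u : Fin n → ℕ) : Fin (n + 1) → ℕ :=
  Fin.insertNth (α := fun _ => ℕ) j v u

def rem {n : ℕ} (j : Fin (n + 1)) (x : Fin (n + 1) → ℕ) : Fin n → ℕ := fun q => x (j.succAbove q)

@[simp] lemma ins_same {n : ℕ} (j : Fin (n + 1)) (v : ℕ) (u : Fin n → ℕ) : ins j v u j = v := by
  simp [ins]

@[simp] lemma ins_succAbove {n : ℕ} (j : Fin (n + 1)) (v : ℕ) (u : Fin n → ℕ) (q : Fin n) :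
    ins j v u (j.succAbove q) = u q := by
  simp [ins]

@[simp] lemma rem_ins {n : ℕ} (j : Fin (n + 1)) (v : ℕ) (u : Fin n → ℕ) : rem j (ins j v u) = u := by
  funext q; simp [rem]

lemma ins_rem {n : ℕ} (j : Fin (n + 1)) (x : Fin (n + 1) → ℕ) : ins j (x j) (rem j x) = x := by
  funext p
  rcases Fin.eq_self_or_eq_succAbove j p with rfl | ⟨q, rfl⟩
  · simp
  · simp [rem]

lemma ins_injective {n : ℕ} (j : Fin (n + 1)) (v : ℕ) : Function.Injective (ins j v) := by
  intro u u' h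
  rw [← rem_ins j v u, h, rem_ins]

lemma ins_update {n : ℕ} (j : Fin (n + 1)) (v : ℕ) (u : Fin n → ℕ) (q : Fin n) (b : ℕ) :
    ins j v (Function.update u q b) = Function.update (ins j v u) (j.succAbove q) b := by
  funext p
  rcases Fin.eq_self_or_eq_succAbove j p with rfl | ⟨q', rfl⟩
  · simp [Function.update_of_ne (Fin.succAbove_ne _ _).symm]
  · by_cases h : q' = q
    · subst h; simp
    · have : j.succAbove q' ≠ j.succAbove q := fun h' => h (Fin.succAbove_right_injective h')
      simp [h]

lemma rk_ins {n : ℕ} (j : Fin (n + 1)) (v : ℕ) (u : Fin n → ℕ) :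
    rk (ins j v u) = (if v ≠ 0 then 1 else 0) + rk u := by
  unfold rk
  rw [Finset.card_filter, Finset.card_filter, Fin.sum_univ_succAbove _ j]
  simp

lemma el_sA {n : ℕ} {j : Fin (n + 1)} {v v' : ℕ} {u u' : Fin n → ℕ} {p q : Fin n} (hp : u p ≠ 0)
    (hq : u' q ≠ 0) :
    el (ins j v u) (j.succAbove p) < el (ins j v' u') (j.succAbove q) ↔ el u p < el u' q := by
  rw [el_lt_iff hp hq, el_lt_iff (by simpa) (by simpa)]
  simp

lemma code_ins_lt {n : ℕ} {j : Fin (n + 1)} {v : ℕ} {u u' : Fin n → ℕ} :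
    code (ins j v u) < code (ins j v u') ↔ code u < code u' := by
  rw [code_lt_iff, code_lt_iff]
  constructor
  · rintro ⟨p, hp, hne, h⟩
    rcases Fin.eq_self_or_eq_succAbove j p with rfl | ⟨p', rfl⟩
    · simp at hne
    · simp only [ins_succAbove] at hp hne
      refine ⟨p', hp, hne, fun q hq hq' => ?_⟩
      have := h (j.succAbove q) (by simpa) (by simpa)
      rwa [el_sA hq hp] at this
  · rintro ⟨p, hp, hne, h⟩
    refine ⟨j.succAbove p, by simpa, by simpa, fun q hq hq' => ?_⟩
    rcases Fin.eq_self_or_eq_succAbove j q with rfl | ⟨q', rfl⟩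
    · simp at hq'
    · simp only [ins_succAbove] at hq hq'
      rw [el_sA hq hp]
      exact h q' hq hq'

/-! ### top classes -/

def jj (n k : ℕ) : Fin (n + 1) := ⟨k % (n + 1), Nat.mod_lt _ (Nat.succ_pos n)⟩
def vv (n k : ℕ) : ℕ := k / (n + 1) + 1
def cc (n k : ℕ) : ℕ := k / (n + 1) * n + k % (n + 1)

lemma vv_ne {n k : ℕ} : vv n k ≠ 0 := by simp [vv]

lemma cc_mono (n : ℕ) : Monotone (cc n) := by
  have e : ∀ k, cc n k = k - k / (n + 1) := by
    intro k
    unfold cc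
    have := Nat.div_add_mod k (n + 1)
    rw [Nat.add_mul, Nat.mul_comm] at this
    omega
  apply monotone_nat_of_le_succ
  intro k
  rw [e, e]
  have : (k + 1) / (n + 1) ≤ k / (n + 1) + 1 := by
    rw [Nat.div_le_iff_le_mul_add_pred (Nat.succ_pos n)]
    have := Nat.lt_mul_div_succ k (Nat.succ_pos n)
    simp only [Nat.succ_eq_add_one] at *
    omega
  have := Nat.div_le_self (k + 1) (n + 1)
  omega

lemma el_eq_iff {n k : ℕ} {x : Fin (n + 1) → ℕ} {p : Fin (n + 1)} (hp : x p ≠ 0) :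
    el x p = k ↔ p = jj n k ∧ x p = vv n k := by
  have hk : k = el (ins (jj n k) (vv n k) 0) (jj n k) := by
    simp only [el, ins_same]
    simp only [vv, jj]
    have := Nat.div_add_mod k (n + 1)
    rw [Nat.mul_comm] at this
    simpa using this.symm
  constructor
  · intro h
    rw [hk] at h
    have := el_inj hp (by simp [vv]) h
    simpa using this
  · rintro ⟨rfl, h⟩
    refine Eq.trans ?_ hk.symm
    simp [el, h]

lemma el_cut {n k : ℕ} {u : Fin n → ℕ} {q : Fin n} (hq : u q ≠ 0) :
    el (ins (jj n k) (vv n k) u) ((jj n k).succAbove q) < k ↔ el u q < cc n k := by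
  set x := ins (jj n k) (vv n k) u with hx
  have hk : el x (jj n k) = k := (el_eq_iff (by simp [hx, vv])).2 ⟨rfl, by simp [hx]⟩
  have hlt : (jj n k).succAbove q < jj n k ↔ (q : ℕ) < k % (n + 1) := by
    rw [Fin.succAbove_lt_iff_castSucc_lt, Fin.lt_def]
    rfl
  have hlhs : el x ((jj n k).succAbove q) < k ↔
      u q < vv n k ∨ (u q = vv n k ∧ (q : ℕ) < k % (n + 1)) := by
    have := el_lt_iff (x := x) (y := x) (p := (jj n k).succAbove q) (q := jj n k)
      (by simpa [hx]) (by simp [hx, vv])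
    rw [hk, hlt] at this
    rw [this]
    simp [hx]
  rw [hlhs]
  unfold el cc vv
  have hmod : k % (n + 1) < n + 1 := Nat.mod_lt _ (Nat.succ_pos n)
  have hqn := q.2
  generalize k / (n + 1) = a at *
  obtain ⟨b, hb⟩ : ∃ b, u q = b + 1 := ⟨u q - 1, by omega⟩
  rw [hb, Nat.add_sub_cancel]
  rcases lt_trichotomy b a with h | h | h
  · have : (b + 1) * n ≤ a * n := Nat.mul_le_mul_right n h
    rw [add_mul] at this
    omega
  · subst h; omega
  · have : (a + 1) * n ≤ b * n := Nat.mul_le_mul_right n h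
    rw [add_mul] at this
    omega

end KK

namespace KK

/-- the statement to be proved, in dimension `n` -/
def Thm (n : ℕ) : Prop :=
  ∀ (r : ℕ) (A C : Finset (Fin n → ℕ)), (∀ x ∈ A, rk x = r) → IsInit r C → C.card = A.card →
    (dShadowN C).card ≤ (dShadowN A).card

/-! ### slices -/

noncomputable def slice {n : ℕ} (A : Finset (Fin (n + 1) → ℕ)) (s : Fin (n + 1)) (t : ℕ) :
    Finset (Fin n → ℕ) := (A.filter fun x => x s = t).image (rem s)

lemma mem_slice {n : ℕ} {A : Finset (Fin (n + 1) → ℕ)} {s : Fin (n + 1)} {t : ℕ} {u : Fin n → ℕ} :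
    u ∈ slice A s t ↔ ins s t u ∈ A := by
  simp only [slice, Finset.mem_image, Finset.mem_filter]
  constructor
  · rintro ⟨x, ⟨hx, rfl⟩, rfl⟩
    rwa [ins_rem]
  · intro h
    exact ⟨_, ⟨h, by simp⟩, by simp⟩

lemma sum_slice {n : ℕ} (X : Finset (Fin (n + 1) → ℕ)) (s : Fin (n + 1)) (N : ℕ)
    (hN : ∀ x ∈ X, x s < N) (g : (Fin (n + 1) → ℕ) → ℕ) :
    ∑ x ∈ X, g x = ∑ t ∈ Finset.range N, ∑ u ∈ slice X s t, g (ins s t u) := by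
  rw [← Finset.sum_fiberwise_of_maps_to (s := X) (t := Finset.range N) (g := fun x => x s)
    (fun x hx => Finset.mem_range.2 (hN x hx))]
  apply Finset.sum_congr rfl
  intro t _
  symm
  apply Finset.sum_bij (fun u _ => ins s t u)
  · intro u hu
    simp [mem_slice.1 hu]
  · intro u _ u' _ h
    exact ins_injective s t h
  · intro x hx
    rw [Finset.mem_filter] at hx
    obtain ⟨hx, rfl⟩ := hx
    exact ⟨rem s x, mem_slice.2 (by rwa [ins_rem]), ins_rem s x⟩
  · intro u _
    rfl

lemma card_slice {n : ℕ} (X : Finset (Fin (n + 1) → ℕ)) (s : Fin (n + 1)) (N : ℕ)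
    (hN : ∀ x ∈ X, x s < N) : X.card = ∑ t ∈ Finset.range N, (slice X s t).card := by
  have := sum_slice X s N hN (fun _ => 1)
  simpa using this

def rr (r t : ℕ) : ℕ := if t = 0 then r + 1 else r

lemma rk_slice {n r : ℕ} {A : Finset (Fin (n + 1) → ℕ)} (hA : ∀ x ∈ A, rk x = r + 1)
    (s : Fin (n + 1)) (t : ℕ) : ∀ u ∈ slice A s t, rk u = rr r t := by
  intro u hu
  have := hA _ (mem_slice.1 hu)
  rw [rk_ins] at this
  unfold rr
  split_ifs with h
  · simp [h] at this; exact this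
  · simp [h] at this; omega

noncomputable def comp {n : ℕ} (r : ℕ) (s : Fin (n + 1)) (A : Finset (Fin (n + 1) → ℕ)) :
    Finset (Fin (n + 1) → ℕ) :=
  (Finset.range (A.sup (fun x => x s) + 1)).biUnion fun t =>
    (Iseg n (rr r t) (slice A s t).card).image (ins s t)

lemma slice_comp {n r : ℕ} (s : Fin (n + 1)) (A : Finset (Fin (n + 1) → ℕ)) (t : ℕ) :
    slice (comp r s A) s t = Iseg n (rr r t) (slice A s t).card := by
  ext u
  rw [mem_slice]
  simp only [comp, Finset.mem_biUnion, Finset.mem_image, Finset.mem_range]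
  constructor
  · rintro ⟨t', ht', u', hu', h⟩
    have h1 : t' = t := by
      have := congrFun h s
      simpa using this
    subst h1
    rw [← ins_injective s t' h]
    exact hu'
  · intro hu
    refine ⟨t, ?_, u, hu, rfl⟩
    by_contra hlt
    have he : slice A s t = ∅ := by
      rw [Finset.eq_empty_iff_forall_notMem]
      intro w hw
      have := Finset.le_sup (f := fun x : Fin (n + 1) → ℕ => x s) (mem_slice.1 hw)
      simp only [ins_same] at this
      omega
    have hc := Iseg_card (n := n) (r := rr r t) (a := 0) ∅ (by simp) (by simp)
    rw [he, Finset.card_empty, Finset.card_eq_zero.1 hc] at hu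
    simp at hu

lemma card_slice_comp {n r : ℕ} (s : Fin (n + 1)) {A : Finset (Fin (n + 1) → ℕ)}
    (hA : ∀ x ∈ A, rk x = r + 1) (t : ℕ) :
    (slice (comp r s A) s t).card = (slice A s t).card := by
  rw [slice_comp]
  exact Iseg_card _ (rk_slice hA s t) le_rfl

lemma rk_comp {n r : ℕ} (s : Fin (n + 1)) {A : Finset (Fin (n + 1) → ℕ)} :
    ∀ x ∈ comp r s A, rk x = r + 1 := by
  intro x hx
  have h : rem s x ∈ slice (comp r s A) s (x s) := mem_slice.2 (by rwa [ins_rem])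
  rw [slice_comp] at h
  have h2 := (Iseg_isInit _ _ _).1 _ h
  rw [← ins_rem s x, rk_ins, h2]
  unfold rr
  split_ifs <;> simp_all
  omega

lemma exists_bound {n : ℕ} (X : Finset (Fin (n + 1) → ℕ)) (s : Fin (n + 1)) :
    ∃ N, ∀ x ∈ X, x s < N :=
  ⟨X.sup (fun x => x s) + 1, fun x hx =>
    Nat.lt_succ_of_le (Finset.le_sup (f := fun x : Fin (n + 1) → ℕ => x s) hx)⟩

lemma exists_bound2 {n : ℕ} (X Y : Finset (Fin (n + 1) → ℕ)) (s : Fin (n + 1)) :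
    ∃ N, (∀ x ∈ X, x s < N) ∧ ∀ x ∈ Y, x s < N := by
  obtain ⟨N, hN⟩ := exists_bound (X ∪ Y) s
  exact ⟨N, fun x hx => hN x (Finset.mem_union_left _ hx),
    fun x hx => hN x (Finset.mem_union_right _ hx)⟩

lemma card_comp {n r : ℕ} (s : Fin (n + 1)) {A : Finset (Fin (n + 1) → ℕ)}
    (hA : ∀ x ∈ A, rk x = r + 1) : (comp r s A).card = A.card := by
  obtain ⟨N, h1, h2⟩ := exists_bound2 A (comp r s A) s
  rw [card_slice A s N h1, card_slice _ s N h2]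
  exact Finset.sum_congr rfl fun t _ => card_slice_comp s hA t

lemma slice_d_ne {n : ℕ} (X : Finset (Fin (n + 1) → ℕ)) (s : Fin (n + 1)) {t : ℕ} (ht : t ≠ 0) :
    slice (dShadowN X) s t = dShadowN (slice X s t) := by
  ext u
  rw [mem_slice, mem_d, mem_d]
  constructor
  · rintro ⟨x, hx, i, hi, h⟩
    rcases Fin.eq_self_or_eq_succAbove s i with rfl | ⟨q, rfl⟩
    · have := congrFun h i
      simp at this
      exact absurd this ht
    · have hxs : x s = t := by
        have := congrFun h s
        simpa using this.symm
      subst hxs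
      refine ⟨rem s x, mem_slice.2 (by rwa [ins_rem]), q, hi, ?_⟩
      apply ins_injective s (x s)
      rw [ins_update, ins_rem, h]
  · rintro ⟨v, hv, q, hq, rfl⟩
    exact ⟨_, mem_slice.1 hv, s.succAbove q, by simpa, ins_update _ _ _ _ _⟩

lemma mem_slice_d_zero {n : ℕ} {X : Finset (Fin (n + 1) → ℕ)} {s : Fin (n + 1)} {u : Fin n → ℕ} :
    u ∈ slice (dShadowN X) s 0 ↔ u ∈ dShadowN (slice X s 0) ∨ ∃ t, t ≠ 0 ∧ u ∈ slice X s t := by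
  rw [mem_slice, mem_d, mem_d]
  constructor
  · rintro ⟨x, hx, i, hi, h⟩
    rcases Fin.eq_self_or_eq_succAbove s i with rfl | ⟨q, rfl⟩
    · right
      refine ⟨x i, hi, mem_slice.2 ?_⟩
      have : u = rem i x := by
        funext q
        have := congrFun h (i.succAbove q)
        simpa [rem] using this
      rwa [this, ins_rem]
    · left
      have hxs : x s = 0 := by
        have := congrFun h s
        simpa using this.symm
      refine ⟨rem s x, mem_slice.2 (by rwa [← hxs, ins_rem]), q, hi, ?_⟩
      apply ins_injective s 0
      rw [ins_update, h]
      congr 1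
      rw [← hxs, ins_rem]
  · rintro (⟨v, hv, q, hq, rfl⟩ | ⟨t, ht, hu⟩)
    · exact ⟨_, mem_slice.1 hv, s.succAbove q, by simpa, ins_update _ _ _ _ _⟩
    · refine ⟨_, mem_slice.1 hu, s, by simpa, ?_⟩
      funext p
      rcases Fin.eq_self_or_eq_succAbove s p with rfl | ⟨q, rfl⟩
      · simp
      · simp

lemma card_le_of_init {n r b : ℕ} (X : Finset (Fin n → ℕ))
    (h : ∀ u ∈ X, ∃ I, IsInit r I ∧ u ∈ I ∧ I.card ≤ b) : X.card ≤ b := by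
  rcases X.eq_empty_or_nonempty with rfl | hne
  · simp
  obtain ⟨u, hu, hmax⟩ := Finset.exists_max_image X code hne
  obtain ⟨I, hI, huI, hc⟩ := h u hu
  refine le_trans (Finset.card_le_card fun x hx => ?_) hc
  obtain ⟨J, hJ, hxJ, _⟩ := h x hx
  exact mem_of_code_le hI huI (hJ.1 x hxJ) (hmax x hx)

lemma d_comp_le {n r : ℕ} (hT : Thm n) (s : Fin (n + 1)) {A : Finset (Fin (n + 1) → ℕ)}
    (hA : ∀ x ∈ A, rk x = r + 1) :
    (dShadowN (comp r s A)).card ≤ (dShadowN A).card := by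
  obtain ⟨N, h1, h2⟩ := exists_bound2 (dShadowN A) (dShadowN (comp r s A)) s
  rw [card_slice _ s N h1, card_slice _ s N h2]
  apply Finset.sum_le_sum
  intro t _
  have hinit : ∀ t, IsInit (rr r t) (slice (comp r s A) s t) := by
    intro t
    rw [slice_comp]; exact Iseg_isInit _ _ _
  have key : ∀ t, (dShadowN (slice (comp r s A) s t)).card ≤ (dShadowN (slice A s t)).card :=
    fun t => hT _ _ _ (rk_slice hA s t) (hinit t) (card_slice_comp s hA t)
  by_cases ht : t = 0
  · subst ht
    apply card_le_of_init (r := r)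
    intro u hu
    rcases mem_slice_d_zero.1 hu with h | ⟨t, ht, h⟩
    · refine ⟨_, (hinit 0).d, h, (key 0).trans (Finset.card_le_card fun v hv => ?_)⟩
      exact mem_slice_d_zero.2 (Or.inl hv)
    · refine ⟨_, ?_, h, ?_⟩
      · have := hinit t
        simpa [rr, ht] using this
      · rw [card_slice_comp s hA]
        exact Finset.card_le_card fun v hv => mem_slice_d_zero.2 (Or.inr ⟨t, ht, hv⟩)
  · rw [slice_d_ne _ _ ht, slice_d_ne _ _ ht]
    exact key t

lemma sum_lt_of_init {n r : ℕ} {I S : Finset (Fin n → ℕ)} (hI : IsInit r I)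
    (hS : ∀ x ∈ S, rk x = r) (hc : I.card = S.card) (hne : I ≠ S) (φ : (Fin n → ℕ) → ℕ)
    (hφ : ∀ x y, code x < code y → φ x < φ y) : ∑ x ∈ I, φ x < ∑ x ∈ S, φ x := by
  have hcd : (I \ S).card = (S \ I).card := Finset.card_sdiff_comm hc
  have hne1 : (I \ S).Nonempty := by
    rw [Finset.sdiff_nonempty]
    intro h
    exact hne (Finset.eq_of_subset_of_card_le h hc.ge)
  have hlt : ∀ x ∈ I \ S, ∀ y ∈ S \ I, φ x < φ y := by
    intro x hx y hy
    rw [Finset.mem_sdiff] at hx hy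
    apply hφ
    by_contra h
    exact hy.2 (mem_of_code_le hI hx.1 (hS y hy.1) (not_lt.1 h))
  obtain ⟨m, hm, hmax⟩ := Finset.exists_max_image (I \ S) φ hne1
  have h1 : ∑ x ∈ I \ S, φ x ≤ (I \ S).card * φ m := by
    have := Finset.sum_le_card_nsmul (I \ S) φ (φ m) hmax
    simpa using this
  have h2 : (S \ I).card * (φ m + 1) ≤ ∑ x ∈ S \ I, φ x := by
    have := Finset.card_nsmul_le_sum (S \ I) φ (φ m + 1) (fun y hy => hlt m hm y hy)
    simpa using this
  have hpos := Finset.card_pos.2 hne1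
  have h3 : ∑ x ∈ I \ S, φ x < ∑ x ∈ S \ I, φ x := by
    rw [← hcd, mul_add] at h2
    omega
  rw [← Finset.sum_inter_add_sum_sdiff I S φ, ← Finset.sum_inter_add_sum_sdiff S I φ,
    Finset.inter_comm S I]
  omega

def Compressed {n : ℕ} (A : Finset (Fin n → ℕ)) : Prop :=
  ∀ y ∈ A, ∀ x, rk x = rk y → (∃ s, x s = y s) → code x < code y → x ∈ A

lemma comp_lt {n r : ℕ} (s : Fin (n + 1)) {A : Finset (Fin (n + 1) → ℕ)}
    (hA : ∀ x ∈ A, rk x = r + 1) {x y : Fin (n + 1) → ℕ} (hy : y ∈ A) (hx : x ∉ A)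
    (hrk : rk x = rk y) (hs : x s = y s) (hlt : code x < code y) :
    ∑ x ∈ comp r s A, code x < ∑ x ∈ A, code x := by
  obtain ⟨N, h1, h2⟩ := exists_bound2 A (comp r s A) s
  rw [sum_slice A s N h1, sum_slice _ s N h2]
  have hinit : ∀ t, IsInit (rr r t) (slice (comp r s A) s t) := by
    intro t
    rw [slice_comp]; exact Iseg_isInit _ _ _
  have hlt' : ∀ t, slice (comp r s A) s t ≠ slice A s t →
      ∑ u ∈ slice (comp r s A) s t, code (ins s t u) < ∑ u ∈ slice A s t, code (ins s t u) :=
    fun t h => sum_lt_of_init (hinit t) (rk_slice hA s t) (card_slice_comp s hA t) h _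
      (fun u v h => code_ins_lt.2 h)
  apply Finset.sum_lt_sum
  · intro t _
    by_cases h : slice (comp r s A) s t = slice A s t
    · rw [h]
    · exact (hlt' t h).le
  · refine ⟨y s, Finset.mem_range.2 (h1 y hy), hlt' _ fun h => ?_⟩
    have hy' : rem s y ∈ slice A s (y s) := mem_slice.2 (by rwa [ins_rem])
    have hx' : rem s x ∈ slice A s (y s) := by
      have hi := hinit (y s)
      rw [h] at hi
      apply hi.2 _ hy'
      · rw [← ins_rem s x, ← ins_rem s y, rk_ins, rk_ins, hs] at hrk
        rw [← rk_slice hA s (y s) _ hy']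
        omega
      · rw [← code_ins_lt (j := s) (v := y s), ins_rem, ← hs, ins_rem]
        exact hlt
    rw [mem_slice, ← hs, ins_rem] at hx'
    exact hx hx'

lemma exists_compressed {n r : ℕ} (hT : Thm n) (A : Finset (Fin (n + 1) → ℕ))
    (hA : ∀ x ∈ A, rk x = r + 1) :
    ∃ B : Finset (Fin (n + 1) → ℕ), (∀ x ∈ B, rk x = r + 1) ∧ B.card = A.card ∧
      (dShadowN B).card ≤ (dShadowN A).card ∧ Compressed B := by
  induction h : ∑ x ∈ A, code x using Nat.strong_induction_on generalizing A with
  | _ k ih =>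
    by_cases hc : Compressed A
    · exact ⟨A, hA, rfl, le_rfl, hc⟩
    · unfold Compressed at hc
      push Not at hc
      obtain ⟨y, hy, x, hrk, ⟨s, hs⟩, hlt, hx⟩ := hc
      have := comp_lt s hA hy hx hrk hs hlt
      rw [h] at this
      obtain ⟨B, hB1, hB2, hB3, hB4⟩ := ih _ this (comp r s A) (rk_comp s) rfl
      exact ⟨B, hB1, hB2.trans (card_comp s hA), hB3.trans (d_comp_le hT s hA), hB4⟩

end KK

namespace KK

def IsTop {n : ℕ} (x : Fin n → ℕ) (k : ℕ) : Prop := k ∈ E x ∧ ∀ e ∈ E x, e ≤ k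

lemma IsTop.unique {n : ℕ} {x : Fin n → ℕ} {k k' : ℕ} (h : IsTop x k) (h' : IsTop x k') :
    k = k' := le_antisymm (h'.2 _ h.1) (h.2 _ h'.1)

lemma exists_top {n : ℕ} {x : Fin n → ℕ} (h : 0 < rk x) : ∃ k, IsTop x k := by
  rw [← card_E, Finset.card_pos] at h
  obtain ⟨k, hk, hmax⟩ := Finset.exists_max_image (E x) id h
  exact ⟨k, hk, hmax⟩

lemma isTop_ins {n k : ℕ} {u : Fin n → ℕ} :
    IsTop (ins (jj n k) (vv n k) u) k ↔ ∀ e ∈ E u, e < cc n k := by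
  have hk : el (ins (jj n k) (vv n k) u) (jj n k) = k :=
    (el_eq_iff (by simp [vv])).2 ⟨rfl, by simp⟩
  constructor
  · intro h e he
    obtain ⟨q, hq, rfl⟩ := mem_E.1 he
    rw [← el_cut hq]
    have h1 := h.2 _ (mem_E.2 ⟨(jj n k).succAbove q, by simpa, rfl⟩)
    refine lt_of_le_of_ne h1 fun h2 => ?_
    have := (el_eq_iff (by simpa)).1 h2
    exact Fin.succAbove_ne _ _ this.1
  · intro h
    refine ⟨mem_E.2 ⟨jj n k, by simp [vv], hk⟩, fun e he => ?_⟩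
    obtain ⟨p, hp, rfl⟩ := mem_E.1 he
    rcases Fin.eq_self_or_eq_succAbove (jj n k) p with hpe | ⟨q, hpe⟩
    · rw [hpe, hk]
    · rw [hpe] at hp ⊢
      have hq : u q ≠ 0 := by simpa using hp
      exact ((el_cut hq).2 (h _ (mem_E.2 ⟨q, hq, rfl⟩))).le

lemma IsTop.val {n k : ℕ} {x : Fin (n + 1) → ℕ} (h : IsTop x k) : x (jj n k) = vv n k := by
  obtain ⟨p, hp, hpk⟩ := mem_E.1 h.1
  obtain ⟨rfl, h2⟩ := (el_eq_iff hp).1 hpk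
  exact h2

lemma IsTop.ins_eq {n k : ℕ} {x : Fin (n + 1) → ℕ} (h : IsTop x k) :
    ins (jj n k) (vv n k) (rem (jj n k) x) = x := by
  rw [← h.val, ins_rem]

noncomputable def blk {n : ℕ} (A : Finset (Fin (n + 1) → ℕ)) (k : ℕ) : Finset (Fin n → ℕ) :=
  (slice A (jj n k) (vv n k)).filter fun u => ∀ e ∈ E u, e < cc n k

lemma mem_blk {n k : ℕ} {A : Finset (Fin (n + 1) → ℕ)} {u : Fin n → ℕ} :
    u ∈ blk A k ↔ ins (jj n k) (vv n k) u ∈ A ∧ ∀ e ∈ E u, e < cc n k := by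
  simp [blk, mem_slice]

lemma card_blk {n : ℕ} (A : Finset (Fin (n + 1) → ℕ)) (K : ℕ) (h0 : ∀ x ∈ A, 0 < rk x)
    (hK : ∀ x ∈ A, ∀ e ∈ E x, e < K) : A.card = ∑ k ∈ Finset.range K, (blk A k).card := by
  have hA : A = (Finset.range K).biUnion fun k => (blk A k).image (ins (jj n k) (vv n k)) := by
    ext x
    simp only [Finset.mem_biUnion, Finset.mem_range, Finset.mem_image]
    constructor
    · intro hx
      obtain ⟨k, hk⟩ := exists_top (h0 x hx)
      have he := hk.ins_eq
      refine ⟨k, hK x hx k hk.1, rem (jj n k) x, mem_blk.2 ⟨?_, ?_⟩, he⟩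
      · rwa [he]
      · rw [← isTop_ins, he]; exact hk
    · rintro ⟨k, _, u, hu, rfl⟩
      exact (mem_blk.1 hu).1
  conv_lhs => rw [hA]
  rw [Finset.card_biUnion]
  · exact Finset.sum_congr rfl fun k _ => Finset.card_image_of_injective _ (ins_injective _ _)
  · intro k _ k' _ hne
    simp only [Function.onFun]
    rw [Finset.disjoint_left]
    intro x hx hx'
    obtain ⟨u, hu, rfl⟩ := Finset.mem_image.1 hx
    obtain ⟨u', hu', h⟩ := Finset.mem_image.1 hx'
    have h1 := isTop_ins.2 (mem_blk.1 hu).2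
    have h2 := isTop_ins.2 (mem_blk.1 hu').2
    rw [h] at h2
    exact hne (h1.unique h2)

lemma E_update_zero {n : ℕ} (x : Fin n → ℕ) (i : Fin n) : E (Function.update x i 0) ⊆ E x := by
  intro e he
  obtain ⟨p, hp, rfl⟩ := mem_E.1 he
  have hpi : p ≠ i := by rintro rfl; simp at hp
  rw [Function.update_of_ne hpi] at hp
  exact mem_E.2 ⟨p, hp, by simp [el, hpi]⟩

lemma d_blk_sub {n k : ℕ} (A : Finset (Fin (n + 1) → ℕ)) :
    dShadowN (blk A k) ⊆ blk (dShadowN A) k := by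
  intro u hu
  obtain ⟨v, hv, q, hq, rfl⟩ := mem_d.1 hu
  rw [mem_blk] at hv ⊢
  refine ⟨mem_d.2 ⟨_, hv.1, (jj n k).succAbove q, by simpa, ins_update _ _ _ _ _⟩, ?_⟩
  exact fun e he => hv.2 e (E_update_zero _ _ he)

lemma E_eq_range {n r : ℕ} {x : Fin n → ℕ} (hr : rk x = r) (h : ∀ e ∈ E x, e < r) :
    E x = Finset.range r := by
  apply Finset.eq_of_subset_of_card_le
  · intro e he
    exact Finset.mem_range.2 (h e he)
  · rw [card_E, hr, Finset.card_range]

lemma rk_le_of_E {n k : ℕ} {x : Fin n → ℕ} (h : ∀ e ∈ E x, e < k) : rk x ≤ k := by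
  rw [← card_E]
  have : E x ⊆ Finset.range k := fun e he => Finset.mem_range.2 (h e he)
  simpa using Finset.card_le_card this

lemma dE_lt {n K : ℕ} {A : Finset (Fin n → ℕ)} (hK : ∀ x ∈ A, ∀ e ∈ E x, e < K) :
    ∀ x ∈ dShadowN A, ∀ e ∈ E x, e < K := by
  intro w hw e he
  obtain ⟨x, hx, i, hi, rfl⟩ := mem_d.1 hw
  exact hK x hx e (E_update_zero _ _ he)

lemma card_d_ge {n r K : ℕ} {A : Finset (Fin (n + 1) → ℕ)} (hA : ∀ x ∈ A, rk x = r + 2)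
    (hK : ∀ x ∈ A, ∀ e ∈ E x, e < K)
    (hf : A.Nonempty → ∃ x ∈ A, ∀ e ∈ E x, e < r + 2) :
    ∑ k ∈ Finset.range K, (dShadowN (blk A k)).card + ind A.card ≤ (dShadowN A).card := by
  have hrd := rk_d (r := r + 1) hA
  rw [card_blk (dShadowN A) K (fun x hx => by rw [hrd x hx]; omega) (dE_lt hK)]
  rcases A.eq_empty_or_nonempty with he | hne
  · have : ind A.card = 0 := by simp [he, ind]
    rw [this, add_zero]
    exact Finset.sum_le_sum fun k _ => Finset.card_le_card (d_blk_sub A)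
  obtain ⟨x, hx, hxE⟩ := hf hne
  have hE := E_eq_range (hA x hx) hxE
  have h1 : r + 1 ∈ E x := by rw [hE]; simp
  obtain ⟨i, hi, hie⟩ := mem_E.1 h1
  have hw : Function.update x i 0 ∈ dShadowN A := mem_d.2 ⟨x, hx, i, hi, rfl⟩
  set w := Function.update x i 0 with hwd
  have hwE : ∀ e ∈ E w, e < r + 1 := by
    intro e he
    have h2 := hxE e (E_update_zero _ _ he)
    refine lt_of_le_of_ne (by omega) fun h3 => ?_
    rw [h3, ← hie, el_mem_E hi, hwd] at he
    simp at he
    exact hi he.symm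
  have hEw := E_eq_range (hrd w hw) hwE
  have htop : IsTop w r := ⟨by rw [hEw]; simp, fun e he => by have := hwE e he; omega⟩
  have hb : (blk (dShadowN A) r).Nonempty := by
    refine ⟨rem (jj n r) w, mem_blk.2 ⟨by rwa [htop.ins_eq], ?_⟩⟩
    rw [← isTop_ins, htop.ins_eq]
    exact htop
  have hb0 : blk A r = ∅ := by
    rw [Finset.eq_empty_iff_forall_notMem]
    intro u hu
    rw [mem_blk, ← isTop_ins] at hu
    have h2 := hA _ hu.1
    have h3 := rk_le_of_E (k := r + 1) fun e he => Nat.lt_succ_of_le (hu.2.2 e he)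
    omega
  have hrK : r < K := by
    have := hK x hx _ h1
    omega
  have hind : ind A.card ≤ ∑ k ∈ Finset.range K, (if k = r then 1 else 0) := by
    rw [Finset.sum_ite_eq' (Finset.range K) r, if_pos (Finset.mem_range.2 hrK)]
    unfold ind
    split_ifs <;> omega
  refine le_trans (Nat.add_le_add_left hind _) ?_
  rw [← Finset.sum_add_distrib]
  apply Finset.sum_le_sum
  intro k _
  split_ifs with h
  · subst h
    rw [hb0]
    simpa [dShadowN] using hb
  · exact Finset.card_le_card (d_blk_sub A)

lemma blk_d_sub {n r k : ℕ} {C : Finset (Fin (n + 1) → ℕ)} (hC : IsInit (r + 2) C) (hk : k ≠ r) :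
    blk (dShadowN C) k ⊆ dShadowN (blk C k) := by
  intro u hu
  rw [mem_blk, ← isTop_ins] at hu
  obtain ⟨hw, ht⟩ := hu
  have hrw := rk_d (r := r + 1) hC.1 _ hw
  have hrn : rk (ins (jj n k) (vv n k) u) < n + 1 := by
    obtain ⟨x, hx, i, hi, h⟩ := mem_d.1 hw
    have h1 := hC.1 x hx
    have h2 := rk_le x
    omega
  obtain ⟨q, hq, hfirst⟩ := exists_first_zero hrn
  have hz := up_mem hC hw hq hfirst
  rcases Fin.eq_self_or_eq_succAbove (jj n k) q with hpe | ⟨q', rfl⟩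
  · rw [hpe] at hq
    simp [vv] at hq
  rw [← ins_update] at hz
  set q := (jj n k).succAbove q' with hqd
  have hqk : (q : ℕ) < k := by
    by_contra hlt
    have hqne : (q : ℕ) ≠ k := by
      intro h
      have hel : el (ins (jj n k) (vv n k) (Function.update u q' 1)) q = k := by
        rw [hqd, el, ins_succAbove, Function.update_self, ← hqd]
        simpa using h
      rw [el_eq_iff (by rw [hqd]; simp)] at hel
      exact Fin.succAbove_ne _ _ hel.1
    have h1 : (q : ℕ) ≤ rk (ins (jj n k) (vv n k) u) := by
      unfold rk
      have hsub : Finset.Iio q ⊆ Finset.univ.filter fun i => ins (jj n k) (vv n k) u i ≠ 0 := by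
        intro i hi
        rw [Finset.mem_Iio] at hi
        simpa using hfirst i hi
      simpa using Finset.card_le_card hsub
    have h3 := rk_le_of_E (k := k + 1) fun e he => Nat.lt_succ_of_le (ht.2 e he)
    omega
  refine mem_d.2 ⟨Function.update u q' 1, mem_blk.2 ⟨hz, ?_⟩, q', by simp, ?_⟩
  · rw [← isTop_ins]
    have hv : (ins (jj n k) (vv n k) (Function.update u q' 1)) (jj n k) ≠ 0 := by simp [vv]
    refine ⟨mem_E.2 ⟨jj n k, hv, (el_eq_iff hv).2 ⟨rfl, by simp⟩⟩, ?_⟩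
    intro e he
    obtain ⟨p, hp, rfl⟩ := mem_E.1 he
    by_cases hpq : p = q
    · rw [hpq, hqd, el, ins_succAbove, Function.update_self, ← hqd]
      simp
      omega
    · rw [ins_update] at hp ⊢
      rw [Function.update_of_ne hpq] at hp
      have : el (Function.update (ins (jj n k) (vv n k) u) ((jj n k).succAbove q') 1) p
          = el (ins (jj n k) (vv n k) u) p := by
        rw [el, Function.update_of_ne hpq, el]
      rw [this]
      exact ht.2 _ (mem_E.2 ⟨p, hp, rfl⟩)
  · rw [hqd, ins_succAbove] at hq
    rw [Function.update_idem, ← hq, Function.update_eq_self]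

lemma card_d_le {n r K : ℕ} {C : Finset (Fin (n + 1) → ℕ)} (hC : IsInit (r + 2) C)
    (hK : ∀ x ∈ C, ∀ e ∈ E x, e < K) :
    (dShadowN C).card ≤ ∑ k ∈ Finset.range K, (dShadowN (blk C k)).card + ind C.card := by
  have hrd := rk_d (r := r + 1) hC.1
  rcases C.eq_empty_or_nonempty with he | hne
  · subst he
    simp [dShadowN]
  rw [card_blk (dShadowN C) K (fun x hx => by rw [hrd x hx]; omega) (dE_lt hK)]
  have hind : ∑ k ∈ Finset.range K, (if k = r then 1 else 0) ≤ ind C.card := by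
    rw [Finset.sum_ite_eq' (Finset.range K) r]
    have := Finset.card_pos.2 hne
    unfold ind
    split_ifs <;> omega
  refine le_trans ?_ (Nat.add_le_add_left hind _)
  rw [← Finset.sum_add_distrib]
  apply Finset.sum_le_sum
  intro k _
  split_ifs with h
  · subst h
    suffices (blk (dShadowN C) k).card ≤ 1 by omega
    rw [Finset.card_le_one]
    have key : ∀ u ∈ blk (dShadowN C) k, E (ins (jj n k) (vv n k) u) = Finset.range (k + 1) := by
      intro u hu
      rw [mem_blk, ← isTop_ins] at hu
      exact E_eq_range (hrd _ hu.1) fun e he => Nat.lt_succ_of_le (hu.2.2 e he)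
    intro u hu u' hu'
    exact ins_injective _ _ (E_inj ((key u hu).trans (key u' hu').symm))
  · exact Finset.card_le_card (blk_d_sub hC h)

/-- the first point of rank `r` -/
def fp (n r : ℕ) : Fin n → ℕ := fun i => if (i : ℕ) < r then 1 else 0

lemma rk_fp {n r : ℕ} (h : r ≤ n) : rk (fp n r) = r := by
  unfold rk fp
  simp only [ne_eq, ite_eq_right_iff, one_ne_zero, imp_false, not_not]
  rw [Fin.card_filter_val_lt]
  omega

lemma fp_E {n r : ℕ} : ∀ e ∈ E (fp n r), e < r := by
  intro e he
  obtain ⟨p, hp, rfl⟩ := mem_E.1 he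
  unfold fp at hp
  simp only [ne_eq, ite_eq_right_iff, one_ne_zero, imp_false, not_not] at hp
  simp [el, fp, hp]

lemma fp_le {n r : ℕ} {x : Fin n → ℕ} (hx : rk x = r) (hne : x ≠ fp n r) :
    code (fp n r) < code x := by
  have hr : r ≤ n := hx ▸ rk_le x
  rcases lt_trichotomy (code (fp n r)) (code x) with h | h | h
  · exact h
  · exact absurd (code_inj h).symm hne
  · exfalso
    have h1 := code_lt_pow.2 (fp_E (n := n) (r := r))
    have h2 := code_lt_pow.1 (h.trans h1)
    exact hne (E_inj ((E_eq_range hx h2).trans (E_eq_range (rk_fp hr) fp_E).symm))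

lemma IsInit.blk {n r : ℕ} {C : Finset (Fin (n + 1) → ℕ)} (hC : IsInit (r + 2) C) (k : ℕ) :
    IsInit (r + 1) (blk C k) := by
  constructor
  · intro u hu
    have := hC.1 _ (mem_blk.1 hu).1
    rw [rk_ins, if_pos vv_ne] at this
    omega
  · intro y hy x hx hlt
    rw [mem_blk] at hy ⊢
    refine ⟨hC.2 _ hy.1 _ ?_ (code_ins_lt.2 hlt), ?_⟩
    · rw [rk_ins, if_pos vv_ne, hx]; omega
    · rw [← code_lt_pow] at hy ⊢
      exact hlt.trans hy.2

lemma blk_sub_T {n r : ℕ} {A : Finset (Fin (n + 1) → ℕ)} (hA : ∀ x ∈ A, rk x = r + 2) (k : ℕ) :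
    blk A k ⊆ T n (r + 1) (cc n k) := by
  intro u hu
  rw [mem_blk] at hu
  have := hA _ hu.1
  rw [rk_ins, if_pos vv_ne] at this
  exact mem_T.2 ⟨by omega, hu.2⟩

lemma T_sub_blk {n r i k : ℕ} {A : Finset (Fin (n + 1) → ℕ)} (hA : T (n + 1) (r + 2) i ⊆ A)
    (hk : k < i) : T n (r + 1) (cc n k) ⊆ blk A k := by
  intro u hu
  rw [mem_T] at hu
  refine mem_blk.2 ⟨hA (mem_T.2 ⟨?_, ?_⟩), hu.2⟩
  · rw [rk_ins, if_pos vv_ne, hu.1]; omega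
  · intro e he
    have := (isTop_ins.2 hu.2).2 e he
    omega

noncomputable def ll (n r k : ℕ) : ℕ := (T n (r + 1) (cc n k)).card

lemma ll_mono (n r : ℕ) : Monotone (ll n r) := fun _ _ h =>
  Finset.card_le_card (T_mono (cc_mono n h))

lemma card_T (n r i : ℕ) : (T (n + 1) (r + 2) i).card = Sm (ll n r) i := by
  rw [card_blk _ i (fun x hx => by rw [(mem_T.1 hx).1]; omega) (fun x hx => (mem_T.1 hx).2)]
  unfold Sm
  apply Finset.sum_congr rfl
  intro k hk
  unfold ll
  congr 1
  exact Finset.Subset.antisymm (blk_sub_T (fun x hx => (mem_T.1 hx).1) k)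
    (T_sub_blk (Finset.Subset.refl _) (Finset.mem_range.1 hk))

lemma specI_F (n r : ℕ) : SpecI (F n (r + 1)) (ll n r) (F (n + 1) (r + 2)) := by
  intro i t ht
  have hi := Iseg_isInit (n + 1) (r + 2) (Sm (ll n r) i + t)
  have hcard : (Iseg (n + 1) (r + 2) (Sm (ll n r) i + t)).card = Sm (ll n r) i + t := by
    apply Iseg_card (T (n + 1) (r + 2) (i + 1)) (fun x hx => (mem_T.1 hx).1)
    rw [card_T, Sm_succ]; omega
  rw [← F_eq hi hcard]
  set C := Iseg (n + 1) (r + 2) (Sm (ll n r) i + t) with hCd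
  have h1 : T (n + 1) (r + 2) i ⊆ C :=
    (T_isInit _ _ _).subset_of_card hi (by rw [card_T, hcard]; omega)
  have h2 : C ⊆ T (n + 1) (r + 2) (i + 1) :=
    hi.subset_of_card (T_isInit _ _ _) (by rw [card_T, hcard, Sm_succ]; omega)
  have hK : ∀ x ∈ C, ∀ e ∈ E x, e < i + 1 := fun x hx => (mem_T.1 (h2 hx)).2
  have hf : C.Nonempty → ∃ x ∈ C, ∀ e ∈ E x, e < r + 2 := by
    rintro ⟨x, hx⟩
    refine ⟨fp (n + 1) (r + 2), ?_, fp_E⟩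
    by_cases hxe : x = fp (n + 1) (r + 2)
    · rwa [← hxe]
    · have hr := hi.1 x hx
      exact hi.2 x hx _ (rk_fp (hr ▸ rk_le x)) (fp_le hr hxe)
  have hd : (dShadowN C).card =
      ∑ k ∈ Finset.range (i + 1), (dShadowN (blk C k)).card + ind C.card :=
    le_antisymm (card_d_le hi hK) (card_d_ge hi.1 hK hf)
  have hfull : ∀ k < i, blk C k = T n (r + 1) (cc n k) := fun k hk =>
    Finset.Subset.antisymm (blk_sub_T hi.1 k) (T_sub_blk h1 hk)
  have hc2 := card_blk C (i + 1) (fun x hx => by rw [hi.1 x hx]; omega) hK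
  rw [Finset.sum_range_succ, hcard] at hc2
  have hs : ∑ k ∈ Finset.range i, (blk C k).card = Sm (ll n r) i := by
    apply Finset.sum_congr rfl
    intro k hk
    rw [hfull k (Finset.mem_range.1 hk)]
    rfl
  have hti : (blk C i).card = t := by omega
  rw [hd, Finset.sum_range_succ, hcard, F_eq (hi.blk i) hti]
  congr 2
  apply Finset.sum_congr rfl
  intro k hk
  rw [hfull k (Finset.mem_range.1 hk)]
  exact F_eq (T_isInit _ _ _) rfl

end KK

namespace KK

lemma key_z {n r k : ℕ} {A : Finset (Fin n → ℕ)} (hA : ∀ x ∈ A, rk x = r + 2)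
    (hc : Compressed A) {x y : Fin n → ℕ} (hx : rk x = r + 2) (hxA : x ∉ A) (hy : y ∈ A)
    (hlt : code x < code y) {p : Fin n} (hp : y p ≠ 0) (hpk : el y p = k) (htop : IsTop y k) :
    ∃ z ∈ A, (∀ q, y q ≠ 0 → q ≠ p → z q = y q) ∧ code z < code x := by
  have hry := hA y hy
  obtain ⟨p0, hp0, hne0, h0⟩ := code_lt_iff.1 hlt
  have hel : ∀ q, x q ≠ 0 → x q ≠ y q → el x q < el y p := fun q h1 h2 =>
    lt_of_lt_of_le (h0 q h1 h2) (hpk ▸ htop.2 _ (mem_E.2 ⟨p0, hp0, rfl⟩))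
  have hns : ∀ s, x s ≠ y s := fun s hs => hxA (hc y hy x (hx.trans hry.symm) ⟨s, hs⟩ hlt)
  obtain ⟨q0, hq0⟩ := exists_nonzero (x := Function.update y p 0)
    (by have := rk_update_zero hp; omega)
  have hq0p : q0 ≠ p := by rintro rfl; simp at hq0
  rw [Function.update_of_ne hq0p] at hq0
  obtain ⟨z, hz1, hz2, ⟨s, hs⟩, hz4⟩ : ∃ z : Fin n → ℕ, rk z = r + 2 ∧ code z < code y ∧
      (∃ s, z s = x s) ∧ (∀ q, y q ≠ 0 → q ≠ p → z q = y q) := by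
    by_cases hxp : x p = 0
    · obtain ⟨q, hq, hyq⟩ : ∃ q, x q ≠ 0 ∧ y q = 0 := by
        by_contra hno
        push Not at hno
        have : rk x < rk y := by
          unfold rk
          apply Finset.card_lt_card
          rw [Finset.ssubset_iff_of_subset]
          · exact ⟨p, by simp [hp], by simp [hxp]⟩
          · intro i hi
            simp only [Finset.mem_filter, Finset.mem_univ, true_and] at hi ⊢
            exact hno i hi
        omega
      have hqp : q ≠ p := by rintro rfl; exact hq hxp
      refine ⟨Function.update (Function.update y p 0) q (x q), ?_, ?_, ⟨q, by simp⟩, ?_⟩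
      · rw [rk_update_nonzero (by simp [hqp, hyq]) hq, rk_update_zero hp, hry]
      · rw [code_lt_iff]
        refine ⟨p, hp, by simpa [hqp.symm] using hp.symm, fun i hi hne => ?_⟩
        have hiq : i = q := by
          by_contra hiq
          rw [Function.update_of_ne hiq] at hi hne
          by_cases hip : i = p
          · subst hip; simp at hi
          · simp [hip] at hne
        subst hiq
        have := hel i hq (hns i)
        simpa [el] using this
      · intro i hi hip
        have hiq : i ≠ q := by rintro rfl; exact hi hyq
        simp [hiq, hip]
    · refine ⟨Function.update y p (x p), ?_, ?_, ⟨p, by simp⟩, ?_⟩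
      · rw [rk_update_same hp hxp, hry]
      · rw [code_lt_iff]
        refine ⟨p, hp, by simpa using hns p, fun i hi hne => ?_⟩
        have hip : i = p := by
          by_contra hip
          simp [hip] at hne
        subst hip
        have := hel i hxp (hns i)
        simpa [el] using this
      · intro i hi hip
        simp [hip]
  have hzA : z ∈ A := hc y hy z (hz1.trans hry.symm) ⟨q0, hz4 q0 hq0 hq0p⟩ hz2
  refine ⟨z, hzA, hz4, ?_⟩
  by_contra hlt2
  rcases (not_lt.1 hlt2).lt_or_eq with h | h
  · exact hxA (hc z hzA x (hx.trans hz1.symm) ⟨s, hs.symm⟩ h)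
  · rw [code_inj h] at hxA; exact hxA hzA

lemma fp_mem {n r : ℕ} {A : Finset (Fin n → ℕ)} (hA : ∀ x ∈ A, rk x = r + 2)
    (hc : Compressed A) (hne : A.Nonempty) : fp n (r + 2) ∈ A := by
  by_contra hf
  obtain ⟨y, hy⟩ := hne
  have hry := hA y hy
  have hyf : ∀ y ∈ A, y ≠ fp n (r + 2) := by rintro y hy rfl; exact hf hy
  obtain ⟨k, hk⟩ := exists_top (x := y) (by omega)
  obtain ⟨p, hp, hpk⟩ := mem_E.1 hk.1
  obtain ⟨z, hz, _, hlt⟩ := key_z hA hc (rk_fp (hry ▸ rk_le y)) hf hy (fp_le hry (hyf y hy)) hp hpk hk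
  have := fp_le (hA z hz) (hyf z hz)
  omega

lemma lift_el {n i k : ℕ} {u : Fin n → ℕ} {q : Fin n} (hq : u q ≠ 0) (h : cc n i ≤ el u q) :
    i ≤ el (ins (jj n k) (vv n k) u) ((jj n k).succAbove q) := by
  have h1 : (q : ℕ) ≤ ((jj n k).succAbove q : ℕ) := by
    unfold Fin.succAbove
    split_ifs <;> simp
  unfold el at h ⊢
  rw [ins_succAbove]
  unfold cc at h
  have hqn := q.2
  have hi := Nat.div_add_mod i (n + 1)
  have hmod : i % (n + 1) < n + 1 := Nat.mod_lt _ (Nat.succ_pos n)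
  generalize i / (n + 1) = a at *
  generalize u q - 1 = b at *
  rw [mul_comm] at hi
  rcases lt_trichotomy b a with hb | hb | hb
  · have : (b + 1) * n ≤ a * n := Nat.mul_le_mul_right n hb
    rw [add_mul] at this
    omega
  · subst hb
    omega
  · have : (a + 1) * (n + 1) ≤ b * (n + 1) := Nat.mul_le_mul_right (n + 1) hb
    rw [add_mul] at this
    omega

lemma blk_le {n r : ℕ} {A : Finset (Fin (n + 1) → ℕ)} (hA : ∀ x ∈ A, rk x = r + 2)
    (hc : Compressed A) {i k : ℕ} (hik : i < k) (hlt : (blk A i).card < ll n r i) :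
    (blk A k).card ≤ ll n r i := by
  by_contra hcon
  rw [not_le] at hcon
  obtain ⟨u, hu, huT⟩ := Finset.exists_mem_notMem_of_card_lt_card hcon
  obtain ⟨u', hu'T, hu'⟩ := Finset.exists_mem_notMem_of_card_lt_card hlt
  have huk := mem_T.1 (blk_sub_T hA k hu)
  obtain ⟨q, hq, hqi⟩ : ∃ q, u q ≠ 0 ∧ cc n i ≤ el u q := by
    by_contra hno
    push Not at hno
    apply huT
    refine mem_T.2 ⟨huk.1, fun e he => ?_⟩
    obtain ⟨q, hq, rfl⟩ := mem_E.1 he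
    exact hno q hq
  rw [mem_T] at hu'T
  set y := ins (jj n k) (vv n k) u with hyd
  set x := ins (jj n i) (vv n i) u' with hxd
  have hy : y ∈ A := (mem_blk.1 hu).1
  have hxA : x ∉ A := fun h => hu' (mem_blk.2 ⟨h, hu'T.2⟩)
  have hyt : IsTop y k := isTop_ins.2 huk.2
  have hxt : IsTop x i := isTop_ins.2 hu'T.2
  have hrx : rk x = r + 2 := by
    rw [hxd, rk_ins, if_pos vv_ne, hu'T.1]; omega
  have hx1 : code x < 2 ^ (i + 1) := code_lt_pow.2 fun e he => Nat.lt_succ_of_le (hxt.2 e he)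
  have hxy : code x < code y := by
    have h2 : 2 ^ k ≤ code y := by
      by_contra h
      exact lt_irrefl _ (code_lt_pow.1 (not_le.1 h) k hyt.1)
    have h3 : 2 ^ (i + 1) ≤ 2 ^ k := Nat.pow_le_pow_right (by norm_num) hik
    omega
  have hpy : y (jj n k) ≠ 0 := by rw [hyt.val]; exact vv_ne
  obtain ⟨z, hz, hz1, hz2⟩ := key_z hA hc hrx hxA hy hxy hpy
    ((el_eq_iff hpy).2 ⟨rfl, hyt.val⟩) hyt
  have hyq : y ((jj n k).succAbove q) ≠ 0 := by rw [hyd, ins_succAbove]; exact hq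
  have hzq := hz1 _ hyq (Fin.succAbove_ne _ _)
  have h1 : i ≤ el y ((jj n k).succAbove q) := lift_el hq hqi
  have h2 : el y ((jj n k).succAbove q) < i + 1 :=
    code_lt_pow.1 (hz2.trans hx1) _ ((el_mem_E hyq).2 hzq)
  obtain ⟨h3, h4⟩ := (el_eq_iff (k := i) hyq).1 (by omega)
  apply hxA
  refine hc y hy x (by rw [hrx, hA y hy]) ⟨jj n i, ?_⟩ hxy
  rw [hxt.val, ← h3, h4]

/-! ### subadditivity -/

def sh {n : ℕ} (M : ℕ) (x : Fin n → ℕ) : Fin n → ℕ := fun i => if x i = 0 then 0 else x i + M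

lemma sh_ne {n M : ℕ} {x : Fin n → ℕ} {i : Fin n} : sh M x i ≠ 0 ↔ x i ≠ 0 := by
  unfold sh
  split_ifs with h <;> simp [h]

lemma rk_sh {n M : ℕ} (x : Fin n → ℕ) : rk (sh M x) = rk x := by
  unfold rk
  simp only [sh_ne]

lemma sh_inj {n M : ℕ} : Function.Injective (sh (n := n) M) := by
  intro x y h
  funext i
  have := congrFun h i
  unfold sh at this
  split_ifs at this <;> omega

lemma sh_update {n M : ℕ} (x : Fin n → ℕ) (i : Fin n) :
    Function.update (sh M x) i 0 = sh M (Function.update x i 0) := by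
  funext j
  by_cases h : j = i
  · subst h; simp [sh]
  · simp [sh, h]

lemma d_sh {n M : ℕ} (A : Finset (Fin n → ℕ)) :
    dShadowN (A.image (sh M)) ⊆ (dShadowN A).image (sh M) := by
  intro w hw
  obtain ⟨y, hy, i, hi, rfl⟩ := mem_d.1 hw
  obtain ⟨x, hx, rfl⟩ := Finset.mem_image.1 hy
  rw [sh_update]
  exact Finset.mem_image_of_mem _ (mem_d.2 ⟨x, hx, i, sh_ne.1 hi, rfl⟩)

lemma d_union {n : ℕ} (A B : Finset (Fin n → ℕ)) :
    dShadowN (A ∪ B) ⊆ dShadowN A ∪ dShadowN B := by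
  intro w hw
  obtain ⟨x, hx, h⟩ := mem_d.1 hw
  rw [Finset.mem_union] at hx ⊢
  rcases hx with hx | hx
  · exact Or.inl (mem_d.2 ⟨x, hx, h⟩)
  · exact Or.inr (mem_d.2 ⟨x, hx, h⟩)

lemma F_rank_zero (n a : ℕ) : F n 0 a = 0 := by
  unfold F
  rw [Finset.card_eq_zero, Finset.eq_empty_iff_forall_notMem]
  intro w hw
  obtain ⟨x, hx, i, hi, rfl⟩ := mem_d.1 hw
  have := (Iseg_isInit n 0 a).1 x hx
  have := rk_update_zero hi
  omega

lemma F_subadd {n r l a b : ℕ} (hT : Thm n) (c : ℕ) (hl : l = (T n (r + 1) c).card) (ha : a ≤ l)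
    (hb : b ≤ l) : F n (r + 1) (a + b) ≤ F n (r + 1) a + F n (r + 1) b := by
  have hTr : ∀ x ∈ T n (r + 1) c, rk x = r + 1 := fun x hx => (mem_T.1 hx).1
  have hca := Iseg_card _ hTr (hl ▸ ha)
  have hcb := Iseg_card _ hTr (hl ▸ hb)
  have hia := Iseg_isInit n (r + 1) a
  have hib := Iseg_isInit n (r + 1) b
  set X := Iseg n (r + 1) a with hX
  set Y := Iseg n (r + 1) b with hY
  set M := X.sup fun x => Finset.univ.sup x with hM
  have hMb : ∀ x ∈ X, ∀ i, x i ≤ M := fun x hx i =>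
    le_trans (Finset.le_sup (f := x) (Finset.mem_univ i))
      (Finset.le_sup (f := fun x : Fin n → ℕ => Finset.univ.sup x) hx)
  have hdisj : Disjoint X (Y.image (sh M)) := by
    rw [Finset.disjoint_left]
    intro x hx hx'
    obtain ⟨y, hy, rfl⟩ := Finset.mem_image.1 hx'
    obtain ⟨i, hi⟩ := exists_nonzero (x := y) (by rw [hib.1 y hy]; omega)
    have := hMb _ hx i
    simp only [sh, hi, if_false] at this
    omega
  have hcard : (X ∪ Y.image (sh M)).card = a + b := by
    rw [Finset.card_union_of_disjoint hdisj, Finset.card_image_of_injective _ sh_inj, hca, hcb]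
  have hrk : ∀ x ∈ X ∪ Y.image (sh M), rk x = r + 1 := by
    intro x hx
    rcases Finset.mem_union.1 hx with hx | hx
    · exact hia.1 x hx
    · obtain ⟨y, hy, rfl⟩ := Finset.mem_image.1 hx
      rw [rk_sh, hib.1 y hy]
  have h1 := hT (r + 1) (X ∪ Y.image (sh M)) (Iseg n (r + 1) (a + b)) hrk (Iseg_isInit _ _ _)
    (by rw [hcard]; exact Iseg_card _ hrk hcard.ge)
  refine h1.trans ((Finset.card_le_card (d_union _ _)).trans ((Finset.card_union_le _ _).trans ?_))
  apply Nat.add_le_add le_rfl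
  refine (Finset.card_le_card (d_sh _)).trans ?_
  exact Finset.card_image_le

lemma d_rank_one {n : ℕ} {A : Finset (Fin n → ℕ)} (hA : ∀ x ∈ A, rk x = 1) :
    (dShadowN A).card = ind A.card := by
  rcases A.eq_empty_or_nonempty with rfl | ⟨x, hx⟩
  · simp [dShadowN, ind]
  · have hne : A.card ≠ 0 := Finset.card_ne_zero_of_mem hx
    rw [ind, if_neg hne]
    apply le_antisymm
    · rw [Finset.card_le_one]
      have key : ∀ w ∈ dShadowN A, w = 0 := by
        intro w hw
        have := rk_d (r := 0) hA w hw
        funext i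
        by_contra hi
        have := rk_update_zero (x := w) (i := i) hi
        omega
      intro a ha b hb
      rw [key a ha, key b hb]
    · rw [Nat.one_le_iff_ne_zero, ← Nat.pos_iff_ne_zero, Finset.card_pos]
      obtain ⟨i, hi⟩ := exists_nonzero (x := x) (by rw [hA x hx]; omega)
      exact ⟨_, mem_d.2 ⟨x, hx, i, hi, rfl⟩⟩

lemma d_rank_zero {n : ℕ} {A : Finset (Fin n → ℕ)} (hA : ∀ x ∈ A, rk x = 0) :
    dShadowN A = ∅ := by
  rw [Finset.eq_empty_iff_forall_notMem]
  intro w hw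
  obtain ⟨x, hx, i, hi, rfl⟩ := mem_d.1 hw
  have := hA x hx
  have := rk_update_zero hi
  omega

def AllGood (n : ℕ) : Prop := ∀ r c, Good (F n r) (T n r c).card

lemma thm_step {n : ℕ} (hT : Thm n) (hG : AllGood n) : Thm (n + 1) := by
  intro r A C hA hC hcard
  rcases r with _ | _ | r
  · rw [d_rank_zero hC.1]; simp
  · rw [d_rank_one hC.1, d_rank_one hA, hcard]
  · obtain ⟨B, hB1, hB2, hB3, hB4⟩ := exists_compressed (r := r + 1) hT A hA
    refine le_trans ?_ hB3
    rw [F_eq hC (hcard.trans hB2.symm)]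
    obtain ⟨K, hK⟩ : ∃ K, ∀ x ∈ B, ∀ e ∈ E x, e < K := by
      refine ⟨B.sup (fun x => (E x).sup id) + 1, fun x hx e he => Nat.lt_succ_of_le ?_⟩
      exact le_trans (Finset.le_sup (f := id) he)
        (Finset.le_sup (f := fun x : Fin (n + 1) → ℕ => (E x).sup id) hx)
    have hge := card_d_ge hB1 hK fun hne => ⟨_, fp_mem hB1 hB4 hne, fp_E⟩
    refine le_trans ?_ hge
    have hc := card_blk B K (fun x hx => by rw [hB1 x hx]; omega) hK
    have hn := numA' (F_zero n (r + 1)) (fun i => hG (r + 1) (cc n i)) (specI_F n r) K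
      (fun k => (blk B k).card) (fun i _ => Finset.card_le_card (blk_sub_T hB1 i))
      (fun i j hij _ h => blk_le hB1 hB4 hij h)
    rw [← hc] at hn
    refine hn.trans (Nat.add_le_add_right (Finset.sum_le_sum fun k _ => ?_) _)
    have hr : ∀ u ∈ blk B k, rk u = r + 1 := fun u hu => (mem_T.1 (blk_sub_T hB1 k hu)).1
    exact hT (r + 1) _ _ hr (Iseg_isInit _ _ _) (Iseg_card _ hr le_rfl)

lemma good_step {n : ℕ} (hT : Thm (n + 1)) (hG : AllGood n) : AllGood (n + 1) := by
  intro r c a b ha hb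
  rcases r with _ | r
  · simp [F_rank_zero]
  refine ⟨fun _ => F_subadd hT c rfl ha hb, fun hab => ?_⟩
  rcases r with _ | r
  · have key : ∀ a, a ≤ (T (n + 1) 1 c).card → F (n + 1) 1 a = ind a := by
      intro a ha
      unfold F
      rw [d_rank_one (Iseg_isInit _ _ _).1, Iseg_card _ (T_isInit _ _ _).1 ha]
    simp only [Nat.zero_add] at *
    rw [key a ha, key b hb, key _ le_rfl, key _ (by omega)]
    unfold ind
    split_ifs <;> omega
  · rw [card_T] at *
    exact numB' (F_zero n (r + 1)) (fun i => hG (r + 1) (cc n i)) (ll_mono n r) (specI_F n r) c a b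
      ha hb hab

lemma d_dim_zero (A : Finset (Fin 0 → ℕ)) : dShadowN A = ∅ := by
  rw [Finset.eq_empty_iff_forall_notMem]
  intro w hw
  obtain ⟨x, hx, i, hi, rfl⟩ := mem_d.1 hw
  exact i.elim0

lemma all (n : ℕ) : Thm n ∧ AllGood n := by
  induction n with
  | zero =>
    constructor
    · intro r A C _ _ _
      rw [d_dim_zero]; simp
    · intro r c a b _ _
      simp [F, d_dim_zero]
  | succ n ih =>
    have h := thm_step ih.1 ih.2
    exact ⟨h, good_step h ih.2⟩

end KK

/-- **Theorem 3.** Let `n ≥ 1`, `0 ≤ r ≤ n`, let `A` be a finite subset of `ℕ_r^n`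
and let `C` be the initial segment of the `≤`-order on `ℕ_r^n` with `|C| = |A|`.
Then `|d(A)| ≥ |d(C)|`. -/
theorem thm_shadow_nat_rank (n r : ℕ) (hn : 1 ≤ n) (hr : r ≤ n)
    (A C : Finset (Fin n → ℕ))
    (hA : ∀ x ∈ A, (Finset.univ.filter fun i => x i ≠ 0).card = r)
    (hCrank : ∀ x ∈ C, (Finset.univ.filter fun i => x i ≠ 0).card = r)
    (hC : ∀ y ∈ C, ∀ x : Fin n → ℕ,
      (Finset.univ.filter fun i => x i ≠ 0).card = r → pleN x y → x ∈ C)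
    (hcard : C.card = A.card) :
    (dShadowN C).card ≤ (dShadowN A).card := by
  refine (KK.all n).1 r A C hA ⟨hCrank, ?_⟩ hcard
  intro y hy x hx hlt
  exact hC y hy x hx (Or.inr (KK.pltN_of_code_lt hlt))
end

section
/- (Claim 1) Let k ≥ 1 and n ≥ 2 be integers. For every A ⊆ [k]^n and every s ∈ {1,…,n}, the C_s-compression of A satisfies |C_s(A)| = |A| and |d(A)| ≥ |d(C_s(A))|. -/
open Finset
open scoped Classical

def Lx {k N : ℕ} (x y : Fin N → Fin (k + 1)) : Prop :=
  ∃ j, x j < y j ∧ ∀ l, x l ≠ y l → l ≠ j →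
    (x l < y j ∧ y l < y j) ∨ (x l ≤ y j ∧ y l ≤ y j ∧ l < j)

noncomputable def zc {k N : ℕ} (x : Fin N → Fin (k + 1)) : ℕ := (rset x 0).card

lemma mem_rset {k N : ℕ} (x : Fin N → Fin (k + 1)) (i : ℕ) (j : Fin N) :
    j ∈ rset x i ↔ (x j : ℕ) = i := by simp [rset]

lemma plt_iff {k N : ℕ} (x y : Fin N → Fin (k + 1)) :
    plt x y ↔ zc y < zc x ∨ (zc x = zc y ∧ Lx x y) := by
  unfold plt zc
  refine or_congr Iff.rfl (and_congr Iff.rfl ?_)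
  constructor
  · rintro ⟨i, ⟨m, hm, hm', hb⟩, ha⟩
    have key : ∀ l, x l ≠ y l → (x l : ℕ) ≤ i ∧ (y l : ℕ) ≤ i := by
      intro l hl
      constructor
      · by_contra h
        have := ha (x l) (by omega)
        have h2 : l ∈ rset x (x l) := by simp [mem_rset]
        rw [this, mem_rset] at h2
        exact hl (Fin.ext h2.symm)
      · by_contra h
        have := ha (y l) (by omega)
        have h2 : l ∈ rset y (y l) := by simp [mem_rset]
        rw [← this, mem_rset] at h2
        exact hl (Fin.ext h2)
    simp only [mem_rset] at hm hm' hb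
    refine ⟨m, ?_, ?_⟩
    · have := key m (by intro h; rw [h] at hm'; exact hm' hm)
      rw [Fin.lt_def]; omega
    · intro l hl hlm
      have h1 := key l hl
      have h2 := hb l
      have h3 : (x l : ℕ) ≠ y l := fun h => hl (Fin.ext h)
      simp only [Fin.lt_def, Fin.le_def] at *
      omega
  · rintro ⟨j, hj, hb⟩
    refine ⟨y j, ⟨j, by simp [mem_rset], ?_, ?_⟩, ?_⟩
    · rw [mem_rset]; rw [Fin.lt_def] at hj; omega
    · intro l hl
      simp only [mem_rset] at hl
      by_cases h : l = j
      · exact h.le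
      · have := hb l (by intro h; rw [h] at hl; omega) h
        simp only [Fin.lt_def, Fin.le_def] at *
        omega
    · intro i hi
      ext l
      simp only [mem_rset]
      by_cases h : x l = y l
      · rw [h]
      · have h3 : (x l : ℕ) ≠ y l := fun h' => h (Fin.ext h')
        by_cases hlj : l = j
        · subst hlj
          simp only [Fin.lt_def, Fin.le_def] at *
          omega
        · have := hb l h hlj
          simp only [Fin.lt_def, Fin.le_def] at *
          omega

lemma Lx_irrefl {k N : ℕ} (x : Fin N → Fin (k + 1)) : ¬ Lx x x := by
  rintro ⟨j, hj, _⟩; exact lt_irrefl _ hj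

lemma Lx_trans {k N : ℕ} {x y z : Fin N → Fin (k + 1)} (h1 : Lx x y) (h2 : Lx y z) : Lx x z := by
  obtain ⟨j, hj, hb⟩ := h1
  obtain ⟨i, hi, hc⟩ := h2
  by_cases h : y j < z i ∨ (y j = z i ∧ j < i)
  · refine ⟨i, ?_, ?_⟩
    · have := hb i
      grind
    · intro l hl hli
      have h1 := hb l
      have h2 := hc l
      grind
  · refine ⟨j, ?_, ?_⟩
    · have := hc j
      grind
    · intro l hl hli
      have h1 := hb l
      have h2 := hc l
      have h3 := hc j
      grind

lemma Lx_total {k N : ℕ} {x y : Fin N → Fin (k + 1)} (h : x ≠ y) : Lx x y ∨ Lx y x := by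
  have hne : (Finset.univ.filter fun l => x l ≠ y l).Nonempty := by
    obtain ⟨l, hl⟩ := Function.ne_iff.mp h
    exact ⟨l, by simpa using hl⟩
  obtain ⟨j, hj, hmax⟩ := Finset.exists_max_image _
    (fun l => toLex (max (x l) (y l), l)) hne
  simp only [Finset.mem_filter, Finset.mem_univ, true_and, Prod.Lex.toLex_le_toLex] at hj hmax
  rcases lt_or_gt_of_ne hj with hlt | hlt
  · left
    refine ⟨j, hlt, fun l hl hlj => ?_⟩
    have := hmax l hl
    grind
  · right
    refine ⟨j, hlt, fun l hl hlj => ?_⟩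
    have := hmax l (Ne.symm hl)
    grind

lemma plt_irrefl {k N : ℕ} (x : Fin N → Fin (k + 1)) : ¬ plt x x := by
  rw [plt_iff]; rintro (h | ⟨_, h⟩)
  · omega
  · exact Lx_irrefl _ h

lemma plt_trans {k N : ℕ} {x y z : Fin N → Fin (k + 1)} (h1 : plt x y) (h2 : plt y z) :
    plt x z := by
  rw [plt_iff] at *
  rcases h1 with h1 | ⟨h1, h1'⟩ <;> rcases h2 with h2 | ⟨h2, h2'⟩
  · left; omega
  · left; omega
  · left; omega
  · right; exact ⟨by omega, Lx_trans h1' h2'⟩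

lemma plt_total {k N : ℕ} {x y : Fin N → Fin (k + 1)} (h : x ≠ y) : plt x y ∨ plt y x := by
  rw [plt_iff, plt_iff]
  rcases lt_trichotomy (zc x) (zc y) with h1 | h1 | h1
  · right; left; exact h1
  · rcases Lx_total h with h2 | h2
    · left; right; exact ⟨h1, h2⟩
    · right; right; exact ⟨h1.symm, h2⟩
  · left; left; exact h1

noncomputable def rk {k N : ℕ} (x : Fin N → Fin (k + 1)) : ℕ :=
  (Finset.univ.filter fun y => ple y x).card

lemma rk_lt {k N : ℕ} {x y : Fin N → Fin (k + 1)} (h : plt x y) : rk x < rk y := by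
  apply Finset.card_lt_card
  rw [Finset.ssubset_iff_of_subset]
  · refine ⟨y, Finset.mem_filter.mpr ⟨Finset.mem_univ _, Or.inl rfl⟩, ?_⟩
    simp only [Finset.mem_filter, Finset.mem_univ, true_and]
    rintro (h1 | h1)
    · subst h1; exact plt_irrefl _ h
    · exact plt_irrefl _ (plt_trans h h1)
  · intro z
    simp only [Finset.mem_filter, Finset.mem_univ, true_and]
    rintro (h1 | h1)
    · subst h1; exact Or.inr h
    · exact Or.inr (plt_trans h1 h)

lemma rk_inj {k N : ℕ} : Function.Injective (rk : (Fin N → Fin (k + 1)) → ℕ) := by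
  intro x y h
  by_contra hne
  rcases plt_total hne with h1 | h1
  · have := rk_lt h1; omega
  · have := rk_lt h1; omega

lemma rk_lt_iff {k N : ℕ} {x y : Fin N → Fin (k + 1)} : rk x < rk y ↔ plt x y := by
  refine ⟨fun h => ?_, rk_lt⟩
  have hne : x ≠ y := by rintro rfl; omega
  rcases plt_total hne with h1 | h1
  · exact h1
  · have := rk_lt h1; omega

/-- down-closed -/
def DC {k N : ℕ} (B : Finset (Fin N → Fin (k + 1))) : Prop :=
  ∀ y ∈ B, ∀ x, plt x y → x ∈ B

lemma DC_total {k N : ℕ} {B C : Finset (Fin N → Fin (k + 1))} (hB : DC B) (hC : DC C) :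
    B ⊆ C ∨ C ⊆ B := by
  by_contra h
  push Not at h
  obtain ⟨h1, h2⟩ := h
  obtain ⟨x, hx, hx'⟩ := Finset.not_subset.mp h1
  obtain ⟨y, hy, hy'⟩ := Finset.not_subset.mp h2
  have hne : x ≠ y := by rintro rfl; exact hx' hy
  rcases plt_total hne with h | h
  · exact hx' (hC _ hy _ h)
  · exact hy' (hB _ hx _ h)

lemma DC_eq {k N : ℕ} {B C : Finset (Fin N → Fin (k + 1))} (hB : DC B) (hC : DC C)
    (h : B.card = C.card) : B = C := by
  rcases DC_total hB hC with h1 | h1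
  · exact Finset.eq_of_subset_of_card_le h1 h.ge
  · exact (Finset.eq_of_subset_of_card_le h1 h.le).symm

lemma initSeg_DC (k N m : ℕ) : DC (initSeg k N m) := by
  intro y hy x h
  have := rk_lt h
  simp only [initSeg, Finset.mem_filter, Finset.mem_univ, true_and] at *
  unfold rk at this
  omega

lemma initSeg_card (k N m : ℕ) (hm : m ≤ Fintype.card (Fin N → Fin (k + 1))) :
    (initSeg k N m).card = m := by
  set T := Fintype.card (Fin N → Fin (k + 1)) with hT
  have himg : Finset.univ.image (rk : (Fin N → Fin (k + 1)) → ℕ) = Finset.Icc 1 T := by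
    apply Finset.eq_of_subset_of_card_le
    · intro r hr
      obtain ⟨x, -, rfl⟩ := Finset.mem_image.mp hr
      rw [Finset.mem_Icc]
      constructor
      · exact Finset.card_pos.mpr ⟨x, Finset.mem_filter.mpr ⟨Finset.mem_univ _, Or.inl rfl⟩⟩
      · exact Finset.card_le_univ _
    · rw [Finset.card_image_of_injective _ rk_inj]; simp [hT]
  have h2 : (initSeg k N m).image rk = Finset.Icc 1 m := by
    ext r
    simp only [initSeg, Finset.mem_image, Finset.mem_filter, Finset.mem_univ, true_and,
      Finset.mem_Icc]
    constructor
    · rintro ⟨x, hx, rfl⟩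
      refine ⟨Finset.card_pos.mpr ⟨x, Finset.mem_filter.mpr ⟨Finset.mem_univ _, Or.inl rfl⟩⟩, hx⟩
    · rintro ⟨h1, h2⟩
      have : r ∈ Finset.univ.image (rk : (Fin N → Fin (k + 1)) → ℕ) := by
        rw [himg, Finset.mem_Icc]; omega
      obtain ⟨x, -, rfl⟩ := Finset.mem_image.mp this
      exact ⟨x, h2, rfl⟩
  rw [← Finset.card_image_of_injective _ rk_inj, h2]; simp

lemma initSeg_card' {k N : ℕ} (A : Finset (Fin N → Fin (k + 1))) :
    (initSeg k N A.card).card = A.card :=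
  initSeg_card _ _ _ (Finset.card_le_univ _)

/-- zero count under updates -/
lemma zc_zero {k N : ℕ} (x : Fin N → Fin (k + 1)) (i : Fin N) (h : x i ≠ 0) :
    zc (Function.update x i 0) = zc x + 1 := by
  have : rset (Function.update x i 0) 0 = insert i (rset x 0) := by
    ext l; simp only [Finset.mem_insert, mem_rset, Function.update_apply]
    split_ifs with h1 <;> simp [h1]
  unfold zc
  rw [this, Finset.card_insert_of_notMem]
  rw [mem_rset]; intro h'; exact h (Fin.ext h')

lemma zc_up {k N : ℕ} (x : Fin N → Fin (k + 1)) (i : Fin N) (v : Fin (k + 1)) (h : x i = 0)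
    (hv : v ≠ 0) : zc (Function.update x i v) + 1 = zc x := by
  have := zc_zero (Function.update x i v) i (by simpa using hv)
  rw [← this]; congr 1
  ext l; simp only [Function.update_apply]; split_ifs with h1 <;> simp [h1, h]

lemma zc_same {k N : ℕ} (x : Fin N → Fin (k + 1)) (i : Fin N) (v : Fin (k + 1)) (h : x i ≠ 0)
    (hv : v ≠ 0) : zc (Function.update x i v) = zc x := by
  have h1 := zc_zero (Function.update x i v) i (by simpa using hv)
  have h2 := zc_zero x i h
  have : Function.update (Function.update x i v) i 0 = Function.update x i 0 := by simp
  rw [this] at h1; omega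

lemma mem_dShadow {k N : ℕ} (A : Finset (Fin N → Fin (k + 1))) (x : Fin N → Fin (k + 1)) :
    x ∈ dShadow A ↔ ∃ u ∈ A, ∃ i, u i ≠ 0 ∧ Function.update u i 0 = x := by
  simp [dShadow]

noncomputable def slc {k n : ℕ} (s : Fin (n + 1)) (t : Fin (k + 1))
    (A : Finset (Fin (n + 1) → Fin (k + 1))) : Finset (Fin n → Fin (k + 1)) :=
  Finset.univ.filter fun y : Fin n → Fin (k + 1) => s.insertNth t y ∈ A

lemma mem_slc {k n : ℕ} (s : Fin (n + 1)) (t : Fin (k + 1))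
    (A : Finset (Fin (n + 1) → Fin (k + 1))) (y : Fin n → Fin (k + 1)) :
    y ∈ slc s t A ↔ (s.insertNth t y : Fin (n + 1) → Fin (k + 1)) ∈ A := by
  simp [slc]

lemma exists_ins {k n : ℕ} (s : Fin (n + 1)) (x : Fin (n + 1) → Fin (k + 1)) :
    ∃ t y, x = (s.insertNth t y : Fin (n + 1) → Fin (k + 1)) :=
  ⟨x s, s.removeNth x, (Fin.insertNth_self_removeNth s x).symm⟩

lemma ins_inj {k n : ℕ} (s : Fin (n + 1)) {t t' : Fin (k + 1)} {y y' : Fin n → Fin (k + 1)}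
    (h : (s.insertNth t y : Fin (n + 1) → Fin (k + 1)) = s.insertNth t' y') : t = t' ∧ y = y' := by
  constructor
  · simpa using congrFun h s
  · ext j; have := congrFun h (s.succAbove j); simp at this; rw [this]

lemma sum_slc {k n : ℕ} (s : Fin (n + 1)) (A : Finset (Fin (n + 1) → Fin (k + 1)))
    (f : (Fin (n + 1) → Fin (k + 1)) → ℕ) :
    ∑ x ∈ A, f x = ∑ t, ∑ y ∈ slc s t A, f (s.insertNth t y) := by
  rw [← Finset.sum_fiberwise A (fun x => x s) f]
  refine Finset.sum_congr rfl fun t _ => ?_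
  symm
  refine Finset.sum_bij (fun y _ => s.insertNth t y) ?_ ?_ ?_ ?_
  · intro y hy; rw [mem_slc] at hy; simp [hy]
  · intro y _ y' _ h; exact (ins_inj s h).2
  · intro x hx
    obtain ⟨t', y, rfl⟩ := exists_ins s x
    simp only [Finset.mem_filter, Fin.insertNth_apply_same] at hx
    obtain ⟨hx, rfl⟩ := hx
    exact ⟨y, by rw [mem_slc]; exact hx, rfl⟩
  · intros; rfl

lemma card_slc {k n : ℕ} (s : Fin (n + 1)) (A : Finset (Fin (n + 1) → Fin (k + 1))) :
    A.card = ∑ t, (slc s t A).card := by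
  have := sum_slc s A (fun _ => 1)
  simpa using this

lemma slc_compress {k n : ℕ} (s : Fin (n + 1)) (t : Fin (k + 1))
    (A : Finset (Fin (n + 1) → Fin (k + 1))) :
    slc s t (compress s A) = initSeg k n (slc s t A).card := by
  ext y
  rw [mem_slc]
  simp only [compress, Finset.mem_biUnion, Finset.mem_image, Finset.mem_univ, true_and]
  constructor
  · rintro ⟨t', y', hy', h⟩
    obtain ⟨rfl, rfl⟩ := ins_inj s h
    exact hy'
  · intro h; exact ⟨t, y, h, rfl⟩

lemma compress_card {k n : ℕ} (s : Fin (n + 1)) (A : Finset (Fin (n + 1) → Fin (k + 1))) :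
    (compress s A).card = A.card := by
  rw [card_slc s, card_slc s A]
  refine Finset.sum_congr rfl fun t _ => ?_
  rw [slc_compress, initSeg_card']

lemma upd_ins_same {k n : ℕ} (s : Fin (n + 1)) (t v : Fin (k + 1)) (y : Fin n → Fin (k + 1)) :
    Function.update (s.insertNth t y : Fin (n + 1) → Fin (k + 1)) s v = s.insertNth v y := by
  ext l
  induction l using Fin.succAboveCases s with
  | x => simp
  | p i => simp [Function.update_apply]

lemma upd_ins {k n : ℕ} (s : Fin (n + 1)) (t v : Fin (k + 1)) (y : Fin n → Fin (k + 1))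
    (i : Fin n) :
    Function.update (s.insertNth t y : Fin (n + 1) → Fin (k + 1)) (s.succAbove i) v
      = s.insertNth t (Function.update y i v) := by
  ext l
  induction l using Fin.succAboveCases s with
  | x => simp [Function.update_apply]
  | p j => simp [Function.update_apply]

lemma mem_slc_d {k n : ℕ} (s : Fin (n + 1)) (t : Fin (k + 1))
    (A : Finset (Fin (n + 1) → Fin (k + 1))) (y : Fin n → Fin (k + 1)) :
    y ∈ slc s t (dShadow A) ↔ y ∈ dShadow (slc s t A) ∨ (t = 0 ∧ ∃ t', t' ≠ 0 ∧ y ∈ slc s t' A) := by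
  rw [mem_slc, mem_dShadow, mem_dShadow]
  constructor
  · rintro ⟨u, hu, i, hi, h⟩
    obtain ⟨t', y', rfl⟩ := exists_ins s u
    induction i using Fin.succAboveCases s with
    | x =>
      rw [upd_ins_same] at h
      obtain ⟨rfl, rfl⟩ := ins_inj s h
      right
      refine ⟨rfl, t', by simpa using hi, by rwa [mem_slc]⟩
    | p j =>
      rw [upd_ins] at h
      obtain ⟨rfl, rfl⟩ := ins_inj s h
      left
      exact ⟨y', by rwa [mem_slc], j, by simpa using hi, rfl⟩
  · rintro (⟨u, hu, i, hi, rfl⟩ | ⟨rfl, t', ht', hy⟩)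
    · rw [mem_slc] at hu
      exact ⟨_, hu, s.succAbove i, by simpa using hi, by rw [upd_ins]⟩
    · rw [mem_slc] at hy
      exact ⟨_, hy, s, by simpa using ht', by rw [upd_ins_same]⟩

lemma zc_ins {k n : ℕ} (s : Fin (n + 1)) (t : Fin (k + 1)) (y : Fin n → Fin (k + 1)) :
    zc (s.insertNth t y : Fin (n + 1) → Fin (k + 1)) = (if t = 0 then 1 else 0) + zc y := by
  unfold zc rset
  rw [Finset.card_filter, Finset.card_filter, Fin.sum_univ_succAbove _ s]
  simp

lemma plt_ins {k n : ℕ} (s : Fin (n + 1)) (t : Fin (k + 1)) {y y' : Fin n → Fin (k + 1)}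
    (h : plt y y') : plt (s.insertNth t y : Fin (n + 1) → Fin (k + 1)) (s.insertNth t y') := by
  rw [plt_iff] at *
  rw [zc_ins, zc_ins]
  rcases h with h | ⟨h, j, hj, hb⟩
  · left; omega
  · right
    refine ⟨by omega, s.succAbove j, by simpa using hj, ?_⟩
    intro l
    induction l using Fin.succAboveCases s with
    | x => simp
    | p i =>
      intro h1 h2
      simp only [Fin.insertNth_apply_succAbove] at h1 ⊢
      have := hb i h1 (by rintro rfl; exact h2 rfl)
      rcases this with h | ⟨h, h', h''⟩
      · exact Or.inl h
      · exact Or.inr ⟨h, h', Fin.succAbove_lt_succAbove_iff.mpr h''⟩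

lemma plt_of_ins {k n : ℕ} (s : Fin (n + 1)) (t : Fin (k + 1)) {y y' : Fin n → Fin (k + 1)}
    (h : plt (s.insertNth t y : Fin (n + 1) → Fin (k + 1)) (s.insertNth t y')) : plt y y' := by
  have hne : y ≠ y' := by rintro rfl; exact plt_irrefl _ h
  rcases plt_total hne with h1 | h1
  · exact h1
  · exact absurd (plt_trans h (plt_ins s t h1)) (plt_irrefl _)

/-- sums of ranks -/
lemma sum_swap {α : Type*} (P Q : Finset α) (f : α → ℕ) (hc : P.card = Q.card)
    (hP : P.Nonempty) (h : ∀ p ∈ P, ∀ q ∈ Q, f p < f q) : ∑ x ∈ P, f x < ∑ x ∈ Q, f x := by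
  obtain ⟨c, hcP, hmax⟩ := Finset.exists_max_image P f hP
  have hQ : Q.Nonempty := by rw [← Finset.card_pos] at *; omega
  calc ∑ x ∈ P, f x ≤ ∑ x ∈ P, f c := Finset.sum_le_sum hmax
    _ = ∑ x ∈ Q, f c := by simp [hc]
    _ < ∑ x ∈ Q, f x := Finset.sum_lt_sum_of_nonempty hQ fun q hq => h c hcP q hq

lemma sum_swap' {α : Type*} [DecidableEq α] (A B : Finset α) (f : α → ℕ) (hc : B.card = A.card)
    (hne : B ≠ A) (h : ∀ p ∈ B \ A, ∀ q ∈ A \ B, f p < f q) :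
    ∑ x ∈ B, f x < ∑ x ∈ A, f x := by
  have h1 := Finset.sum_sdiff (f := f) (Finset.inter_subset_left (s₁ := A) (s₂ := B))
  have h2 := Finset.sum_sdiff (f := f) (Finset.inter_subset_right (s₁ := A) (s₂ := B))
  have e1 : A \ (A ∩ B) = A \ B := by ext; simp
  have e2 : B \ (A ∩ B) = B \ A := by ext; simp
  rw [e1] at h1; rw [e2] at h2
  have hc' : (B \ A).card = (A \ B).card := Finset.card_sdiff_comm hc
  have hn : (B \ A).Nonempty := by
    rw [Finset.nonempty_iff_ne_empty]
    intro h0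
    rw [Finset.sdiff_eq_empty_iff_subset] at h0
    exact hne (Finset.eq_of_subset_of_card_le h0 hc.ge)
  have := sum_swap _ _ f hc' hn h
  omega

lemma DC_sum {k n : ℕ} (A B : Finset (Fin n → Fin (k + 1))) (f : (Fin n → Fin (k + 1)) → ℕ)
    (hf : ∀ x y, plt x y → f x < f y) (hB : DC B) (hc : B.card = A.card) (hne : B ≠ A) :
    ∑ x ∈ B, f x < ∑ x ∈ A, f x := by
  apply sum_swap' _ _ _ hc hne
  intro p hp q hq
  rw [Finset.mem_sdiff] at hp hq
  apply hf
  have : p ≠ q := by rintro rfl; exact hp.2 hq.1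
  rcases plt_total this with h | h
  · exact h
  · exact absurd (hB _ hp.1 _ h) hq.2

noncomputable def Phi {k N : ℕ} (A : Finset (Fin N → Fin (k + 1))) : ℕ := ∑ x ∈ A, rk x

def Stable {k N : ℕ} (A : Finset (Fin N → Fin (k + 1))) : Prop :=
  ∀ x y, plt x y → (∃ s, x s = y s) → y ∈ A → x ∈ A

lemma compress_Phi {k n : ℕ} (s : Fin (n + 1)) (A : Finset (Fin (n + 1) → Fin (k + 1)))
    (x y : Fin (n + 1) → Fin (k + 1)) (hxy : plt x y) (hs : x s = y s) (hy : y ∈ A) (hx : x ∉ A) :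
    Phi (compress s A) < Phi A := by
  unfold Phi
  rw [sum_slc s, sum_slc s A]
  have key : ∀ t, initSeg k n (slc s t A).card ≠ slc s t A →
      ∑ y ∈ slc s t (compress s A), rk (s.insertNth t y : Fin (n + 1) → Fin (k + 1)) <
      ∑ y ∈ slc s t A, rk (s.insertNth t y : Fin (n + 1) → Fin (k + 1)) := by
    intro t ht
    rw [slc_compress]
    exact DC_sum _ _ _ (fun x y h => rk_lt (plt_ins s t h)) (initSeg_DC _ _ _) (initSeg_card' _) ht
  apply Finset.sum_lt_sum
  · intro t _
    by_cases ht : initSeg k n (slc s t A).card = slc s t A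
    · rw [slc_compress, ht]
    · exact (key t ht).le
  · obtain ⟨t, x', rfl⟩ := exists_ins s x
    obtain ⟨t', y', rfl⟩ := exists_ins s y
    simp only [Fin.insertNth_apply_same] at hs
    subst hs
    refine ⟨t, Finset.mem_univ _, key t ?_⟩
    intro h
    rw [← mem_slc, ← h] at hx hy
    exact hx (initSeg_DC _ _ _ _ hy _ (plt_of_ins s t hxy))

lemma first_zero {k N : ℕ} (x : Fin N → Fin (k + 1)) (i : Fin N) (hi : x i = 0) :
    ∃ f, x f = 0 ∧ (∀ l, l < f → x l ≠ 0) ∧ f ≤ i := by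
  obtain ⟨f, hf, hmin⟩ := Finset.exists_min_image (Finset.univ.filter fun l => x l = 0) id
    ⟨i, by simpa using hi⟩
  simp only [Finset.mem_filter, Finset.mem_univ, true_and, id] at hf hmin
  exact ⟨f, hf, fun l hl h => absurd (hmin l h) (not_le.mpr hl), hmin i hi⟩

lemma one_le_of_ne {k : ℕ} (a : Fin (k + 2)) (h : a ≠ 0) : 1 ≤ a := by
  rw [Fin.le_def]
  have : (a : ℕ) ≠ 0 := fun h' => h (Fin.ext h')
  simp; omega

lemma lt_one_iff0 {k : ℕ} (a : Fin (k + 2)) : a < 1 ↔ a = 0 := by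
  rw [Fin.lt_def, Fin.ext_iff]
  simp

lemma up_min {k N : ℕ} (x : Fin N → Fin (k + 2)) (f i : Fin N) (v : Fin (k + 2)) (hf : x f = 0)
    (hfi : f ≤ i) (hi : x i = 0) (hv : v ≠ 0) :
    Function.update x f 1 = Function.update x i v ∨
      plt (Function.update x f 1) (Function.update x i v) := by
  have h1v := one_le_of_ne v hv
  by_cases h : f = i ∧ v = 1
  · obtain ⟨rfl, rfl⟩ := h; exact Or.inl rfl
  · right
    rw [plt_iff]; right
    refine ⟨?_, i, ?_, ?_⟩
    · have e1 := zc_up x f 1 hf (by simp)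
      have e2 := zc_up x i v hi hv
      omega
    · simp only [Function.update_apply]
      have : (0 : Fin (k + 2)) < v := Fin.pos_iff_ne_zero.mpr hv
      grind
    · intro l
      simp only [Function.update_apply]
      have : (0 : Fin (k + 2)) ≤ v := Fin.zero_le _
      grind

lemma up_mono {k N : ℕ} (x' x : Fin N → Fin (k + 2)) (f' f : Fin N) (h : plt x' x)
    (hz : zc x' = zc x) (hf' : x' f' = 0) (hfm' : ∀ l, l < f' → x' l ≠ 0)
    (hf : x f = 0) (hfm : ∀ l, l < f → x l ≠ 0) :
    Function.update x' f' 1 = Function.update x f 1 ∨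
      plt (Function.update x' f' 1) (Function.update x f 1) := by
  rw [plt_iff] at h
  rcases h with h | ⟨-, j, hj, hb⟩
  · omega
  have ez' := zc_up x' f' 1 hf' (by simp)
  have ez := zc_up x f 1 hf (by simp)
  have hjf : j ≠ f := by rintro rfl; rw [hf] at hj; simp at hj
  have hxj : x j ≠ 0 := by intro h; rw [h] at hj; simp at hj
  have h1j := one_le_of_ne _ hxj
  have h0 : (0 : Fin (k + 2)) < 1 := by simp
  have hfj : x j = 1 → f < j := by
    intro h1
    have hx'j : x' j = 0 := (lt_one_iff0 _).mp (h1 ▸ hj)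
    have hex : ∃ l, x l = 0 ∧ x' l ≠ 0 := by
      by_contra hno
      push Not at hno
      have hss : rset x 0 ⊂ rset x' 0 := by
        rw [Finset.ssubset_iff_of_subset]
        · refine ⟨j, ?_, ?_⟩
          · rw [mem_rset, hx'j]; rfl
          · rw [mem_rset, h1]; simp
        · intro l hl
          rw [mem_rset] at *
          have := hno l (Fin.ext hl)
          rw [this]; rfl
      have := Finset.card_lt_card hss
      unfold zc at hz; omega
    obtain ⟨l, hl, hl'⟩ := hex
    have hlj : l ≠ j := by rintro rfl; exact hl' hx'j
    have hbl := hb l (by rw [hl]; exact hl') hlj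
    rw [h1, lt_one_iff0] at hbl
    have hlj' : l < j := by
      rcases hbl with hbl | hbl
      · exact absurd hbl.1 hl'
      · exact hbl.2.2
    by_contra hn
    exact hfm l (by omega) hl
  by_cases hcase : f' = j ∧ x j = 1
  · obtain ⟨rfl, hx1⟩ := hcase
    left
    have hd : ∀ l, x' l ≠ x l → l ≠ f' → x' l = 1 ∧ x l = 0 := by
      intro l hl hlf
      have hbl := hb l hl hlf
      rw [hx1] at hbl
      have a0 := lt_one_iff0 (x' l)
      have b0 := lt_one_iff0 (x l)
      have := hfm' l
      grind
    have hsub : rset (Function.update x' f' 1) 0 ⊆ rset (Function.update x f 1) 0 := by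
      intro l hl
      rw [mem_rset] at *
      have hl0 : Function.update x' f' 1 l = 0 := Fin.ext hl
      have : Function.update x f 1 l = 0 := by
        simp only [Function.update_apply] at *
        have := hd l
        have := hd f
        have := hfj hx1
        have := hfm l
        grind
      simp [this]
    have heq := Finset.eq_of_subset_of_card_le hsub (by unfold zc at ez ez' hz; omega)
    funext l
    have hl : l ∈ rset (Function.update x' f' 1) 0 ↔ l ∈ rset (Function.update x f 1) 0 := by
      rw [heq]
    simp only [mem_rset] at hl
    have hl' : Function.update x' f' 1 l = 0 ↔ Function.update x f 1 l = 0 := by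
      rw [Fin.ext_iff, Fin.ext_iff]; exact hl
    have := hd l
    simp only [Function.update_apply] at *
    grind
  · right
    rw [plt_iff]; right
    refine ⟨by omega, j, ?_, ?_⟩
    · simp only [Function.update_apply]
      grind
    · intro l
      have := hb l
      have := hb f'
      have := hb f
      have a0 := lt_one_iff0 (x j)
      have := Fin.pos_iff_ne_zero.mpr hxj
      have b0 := lt_one_iff0 (x l)
      have c0 := lt_one_iff0 (x' l)
      have := Fin.zero_le (x l)
      have := Fin.zero_le (x' l)
      have := hfm' j
      have d0 := lt_one_iff0 (x' j)
      simp only [Function.update_apply]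
      grind

lemma exists_zero_of_zc {k N : ℕ} (x : Fin N → Fin (k + 1)) (h : 0 < zc x) : ∃ i, x i = 0 := by
  obtain ⟨i, hi⟩ := Finset.card_pos.mp h
  rw [mem_rset] at hi
  exact ⟨i, Fin.ext hi⟩

lemma DC_shadow {k N : ℕ} (B : Finset (Fin N → Fin (k + 2))) (hB : DC B) : DC (dShadow B) := by
  intro x hx x' h
  rw [mem_dShadow] at *
  obtain ⟨u, hu, i, hi, rfl⟩ := hx
  have ezu := zc_zero u i hi
  set x := Function.update u i 0 with hxdef
  have hxi : x i = 0 := by simp [hxdef]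
  have hux : u = Function.update x i (u i) := by simp [hxdef]
  have hzz : zc x ≤ zc x' := by
    rw [plt_iff] at h
    omega
  obtain ⟨e, he⟩ := exists_zero_of_zc x' (by omega)
  obtain ⟨f', hf', hfm', -⟩ := first_zero x' e he
  obtain ⟨f, hf, hfm, hfi⟩ := first_zero x i hxi
  refine ⟨Function.update x' f' 1, ?_, f', by simp, ?_⟩
  swap
  · funext l; simp only [Function.update_apply]; grind
  have ez' := zc_up x' f' 1 hf' (by simp)
  rcases hzz.lt_or_eq with hlt | heq
  · apply hB _ hu
    rw [plt_iff]; left; omega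
  · have h1 := up_mono x' x f' f h heq.symm hf' hfm' hf hfm
    have h2 := up_min x f i (u i) hf hfi hxi hi
    rw [← hux] at h2
    have h3 : Function.update x f 1 ∈ B := by
      rcases h2 with h2 | h2
      · rw [h2]; exact hu
      · exact hB _ hu _ h2
    rcases h1 with h1 | h1
    · rw [h1]; exact h3
    · exact hB _ h3 _ h1

lemma claim_step {k n : ℕ} (IH : ∀ B : Finset (Fin n → Fin (k + 2)),
    (dShadow (initSeg (k + 1) n B.card)).card ≤ (dShadow B).card)
    (A : Finset (Fin (n + 1) → Fin (k + 2))) (s : Fin (n + 1)) :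
    (dShadow (compress s A)).card ≤ (dShadow A).card := by
  rw [card_slc s, card_slc s (dShadow A)]
  apply Finset.sum_le_sum
  intro t _
  have e1 : ∀ C : Finset (Fin (n + 1) → Fin (k + 2)), dShadow (slc s t C) ⊆ slc s t (dShadow C) := by
    intro C y hy
    rw [mem_slc_d]; exact Or.inl hy
  by_cases ht : t = 0
  · -- union of nested sets
    have key : ∀ (F : Finset (Finset (Fin n → Fin (k + 2)))), (∀ B ∈ F, DC B ∧
        B.card ≤ (slc s t (dShadow A)).card) →
        DC (F.biUnion id) ∧ (F.biUnion id).card ≤ (slc s t (dShadow A)).card := by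
      intro F
      induction F using Finset.induction_on with
      | empty => intro _; simp [DC]
      | insert B F hBF ih =>
        intro h
        have h1 := ih fun B hB => h B (Finset.mem_insert_of_mem hB)
        have h2 := h B (Finset.mem_insert_self _ _)
        rw [Finset.biUnion_insert]
        simp only [id]
        rcases DC_total h1.1 h2.1 with h3 | h3
        · rw [Finset.union_eq_left.mpr h3]; exact h2
        · rw [Finset.union_eq_right.mpr h3]; exact h1
    have h4 := key (insert (dShadow (slc s t (compress s A)))
      ((Finset.univ.filter fun t' : Fin (k + 2) => t' ≠ 0).image
        fun t' => slc s t' (compress s A))) ?_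
    · refine le_trans (Finset.card_le_card ?_) h4.2
      intro y hy
      rw [mem_slc_d] at hy
      rw [Finset.mem_biUnion]
      rcases hy with hy | ⟨-, t', ht', hy⟩
      · exact ⟨_, Finset.mem_insert_self _ _, hy⟩
      · refine ⟨_, Finset.mem_insert_of_mem (Finset.mem_image.mpr ⟨t', by simpa using ht', rfl⟩), hy⟩
    · intro B hB
      rw [Finset.mem_insert, Finset.mem_image] at hB
      rcases hB with rfl | ⟨t', ht', rfl⟩
      · rw [slc_compress]
        exact ⟨DC_shadow _ (initSeg_DC _ _ _), (IH _).trans (Finset.card_le_card (e1 A))⟩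
      · rw [slc_compress]
        refine ⟨initSeg_DC _ _ _, ?_⟩
        rw [initSeg_card']
        apply Finset.card_le_card
        intro y hy
        rw [mem_slc_d]
        exact Or.inr ⟨ht, t', by simpa using ht', hy⟩
  · have e2 : ∀ C : Finset (Fin (n + 1) → Fin (k + 2)),
        slc s t (dShadow C) = dShadow (slc s t C) := by
      intro C
      apply Finset.Subset.antisymm _ (e1 C)
      intro y hy
      rw [mem_slc_d] at hy
      rcases hy with hy | hy
      · exact hy
      · exact absurd hy.1 ht
    rw [e2, e2, slc_compress]
    exact IH _

lemma zc_eq_zero_iff {k N : ℕ} (x : Fin N → Fin (k + 1)) : zc x = 0 ↔ ∀ i, x i ≠ 0 := by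
  unfold zc
  rw [Finset.card_eq_zero, Finset.eq_empty_iff_forall_notMem]
  refine forall_congr' fun i => ?_
  rw [mem_rset, not_iff_not, Fin.ext_iff]; rfl

lemma zc_pos_of {k N : ℕ} (x : Fin N → Fin (k + 1)) (i : Fin N) (h : x i = 0) : 0 < zc x := by
  by_contra hn
  exact (zc_eq_zero_iff x).mp (by omega) i h

noncomputable def G {k N : ℕ} (x : Fin N → Fin (k + 2)) : Finset (Fin N) :=
  Finset.univ.filter fun i => x i = 1 ∧ ∀ l, l < i → x l ≠ 0

lemma mem_G {k N : ℕ} (x : Fin N → Fin (k + 2)) (i : Fin N) :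
    i ∈ G x ↔ x i = 1 ∧ ∀ l, l < i → x l ≠ 0 := by simp [G]

lemma cover_ge {k N : ℕ} (M u : Fin N → Fin (k + 2)) (i i' : Fin N) (hi : i ∈ G M)
    (hu : u i' ≠ 0) (h : Function.update u i' 0 = Function.update M i 0) : M = u ∨ plt M u := by
  rw [mem_G] at hi
  have hx : Function.update M i 0 i' = 0 := by rw [← h]; simp
  have hii : i ≤ i' := by
    by_contra hn
    have h1 := hi.2 i' (by omega)
    rw [Function.update_of_ne (by omega)] at hx
    exact h1 hx
  have := up_min (Function.update M i 0) i i' (u i') (by simp) hii hx hu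
  rw [← h] at this
  have e1 : Function.update (Function.update u i' 0) i' (u i') = u := by simp
  have e2 : Function.update (Function.update u i' 0) i 1 = M := by
    rw [h, ← hi.1]; simp
  rwa [e1, e2] at this

lemma low_cover {k N : ℕ} (m : Fin N → Fin (k + 2)) (i : Fin N) (hi : m i ≠ 0) (hG : i ∉ G m) :
    ∃ u, plt u m ∧ ∃ i', u i' ≠ 0 ∧ Function.update u i' 0 = Function.update m i 0 := by
  have hx : Function.update m i 0 i = 0 := by simp
  obtain ⟨f, hf, hfm, hfi⟩ := first_zero _ i hx
  have := up_min (Function.update m i 0) f i (m i) hf hfi hx hi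
  have e1 : Function.update (Function.update m i 0) i (m i) = m := by simp
  rw [e1] at this
  rcases this with h | h
  · exfalso
    apply hG
    rw [mem_G]
    have hff : m f = 1 := by rw [← h]; simp
    have : f = i := by
      by_contra hne
      rw [Function.update_of_ne hne] at hf
      rw [hf] at hff; simp at hff
    subst this
    refine ⟨hff, fun l hl => ?_⟩
    have := hfm l hl
    rwa [Function.update_of_ne hl.ne] at this
  · refine ⟨_, h, f, by simp, ?_⟩
    funext l
    simp only [Function.update_apply] at *
    grind

lemma upd_zero_inj {k N : ℕ} (M : Fin N → Fin (k + 1)) (i i' : Fin N) (hi : M i ≠ 0)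
    (h : Function.update M i 0 = Function.update M i' 0) : i = i' := by
  by_contra hne
  have := congrFun h i
  rw [Function.update_self, Function.update_of_ne hne] at this
  exact hi this.symm

lemma swapA {k N : ℕ} (A : Finset (Fin N → Fin (k + 2))) (m M : Fin N → Fin (k + 2))
    (hmin : ∀ z, plt z m → z ∈ A) (hM : M ∈ A) (hmax : ∀ z, plt M z → z ∉ A)
    (hmM : plt m M) (hg : (G m).card ≤ (G M).card) :
    (dShadow (insert m (A.erase M))).card ≤ (dShadow A).card := by
  set I := (G M).image fun i => Function.update M i 0 with hI
  set J := (G m).image fun i => Function.update m i 0 with hJ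
  have hne0 : ∀ (x : Fin N → Fin (k + 2)) (i : Fin N), i ∈ G x → x i ≠ 0 := by
    intro x i hi; rw [mem_G] at hi; rw [hi.1]; simp
  have hIs : I ⊆ dShadow A := by
    intro y hy
    rw [hI, Finset.mem_image] at hy
    obtain ⟨i, hi, rfl⟩ := hy
    rw [mem_dShadow]
    exact ⟨M, hM, i, hne0 _ _ hi, rfl⟩
  have hIc : I.card = (G M).card := by
    apply Finset.card_image_of_injOn
    intro i hi i' _ h
    exact upd_zero_inj M i i' (hne0 _ _ hi) h
  have hJc : J.card ≤ (G m).card := Finset.card_image_le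
  have hsub : dShadow (insert m (A.erase M)) ⊆ (dShadow A \ I) ∪ J := by
    intro y hy
    rw [mem_dShadow] at hy
    obtain ⟨u, hu, i, hi, rfl⟩ := hy
    have huM : ¬ (M = u ∨ plt M u) := by
      rw [Finset.mem_insert, Finset.mem_erase] at hu
      rintro (rfl | h)
      · rcases hu with hu | hu
        · subst hu; exact plt_irrefl _ hmM
        · exact hu.1 rfl
      · rcases hu with hu | hu
        · subst hu; exact plt_irrefl _ (plt_trans hmM h)
        · exact hmax u h hu.2
    have hnI : Function.update u i 0 ∉ I := by
      intro h
      rw [hI, Finset.mem_image] at h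
      obtain ⟨i', hi', h⟩ := h
      exact huM (cover_ge M u i' i hi' hi h.symm)
    rw [Finset.mem_union, Finset.mem_sdiff]
    rw [Finset.mem_insert, Finset.mem_erase] at hu
    rcases hu with rfl | hu
    · by_cases hG : i ∈ G u
      · right; exact Finset.mem_image_of_mem _ hG
      · left
        refine ⟨?_, hnI⟩
        obtain ⟨w, hw, i', hi', h⟩ := low_cover u i hi hG
        rw [mem_dShadow]
        exact ⟨w, hmin w hw, i', hi', h⟩
    · left
      refine ⟨?_, hnI⟩
      rw [mem_dShadow]
      exact ⟨u, hu.2, i, hi, rfl⟩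
  have h1 := Finset.card_le_card hsub
  have h2 := Finset.card_union_le (dShadow A \ I) J
  have h3 := Finset.card_sdiff_add_card_eq_card hIs
  omega

lemma swapB {k N : ℕ} (A : Finset (Fin N → Fin (k + 2))) (m M : Fin N → Fin (k + 2))
    (hM : M ∈ A) (hB : ∀ i, m i ≠ 0 → ∃ j, M j ≠ 0 ∧ Function.update M j 0 = Function.update m i 0) :
    (dShadow (insert m (A.erase M))).card ≤ (dShadow A).card := by
  apply Finset.card_le_card
  intro y hy
  rw [mem_dShadow] at *
  obtain ⟨u, hu, i, hi, rfl⟩ := hy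
  rw [Finset.mem_insert, Finset.mem_erase] at hu
  rcases hu with rfl | hu
  · obtain ⟨j, hj, h⟩ := hB i hi
    exact ⟨M, hM, j, hj, h⟩
  · exact ⟨u, hu.2, i, hi, rfl⟩

/-- the move of a leading one to a later zero coordinate gives something between -/
lemma S2 {k N : ℕ} (m M : Fin N → Fin (k + 2)) (hdiff : ∀ i, m i ≠ M i)
    (hbet : ∀ z a b, plt m z → plt z M → z a = m a → z b = M b → False)
    (i c e : Fin N) (hi : i ∈ G m) (hMi : M i = 0) (hc : m c = 0) (hei : e ≠ i) (hec : e ≠ c)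
    (hlt : zc M < zc m ∨ (zc m = zc M ∧ ∃ j, m j < M j ∧ j ≠ i ∧ (1 < M j ∨ c ≠ j) ∧
      ∀ l, l ≠ j → (m l < M j ∧ M l < M j) ∨ (m l ≤ M j ∧ M l ≤ M j ∧ l < j))) : False := by
  rw [mem_G] at hi
  have hci : i ≠ c := by rintro rfl; rw [hi.1] at hc; simp at hc
  have hlti : i < c := by
    by_contra hn
    exact hi.2 c (by omega) hc
  have h01 : (0 : Fin (k + 2)) < 1 := by simp
  have z1 := zc_zero m i (by rw [hi.1]; simp)
  have z2 := zc_up (Function.update m i 0) c 1 (by rw [Function.update_of_ne hci.symm]; exact hc)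
    (by simp)
  refine hbet (Function.update (Function.update m i 0) c 1) e i ?_ ?_ ?_ ?_
  · rw [plt_iff]; right
    refine ⟨by omega, c, ?_, ?_⟩
    · simp [hc]
    · intro l
      simp only [Function.update_apply]
      grind
  · rw [plt_iff]
    rcases hlt with hlt | ⟨hz, j, hj, hji, hcj, hb⟩
    · left; omega
    · right
      have hMj : M j ≠ 0 := by intro h; rw [h] at hj; simp at hj
      have h1j := one_le_of_ne _ hMj
      refine ⟨by omega, j, ?_, ?_⟩
      · simp only [Function.update_apply]
        grind
      · intro l
        have := hb l
        have hdl := hdiff l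
        have := one_le_of_ne (M l)
        simp only [Function.update_apply]
        grind
  · simp only [Function.update_apply]; grind
  · simp only [Function.update_apply]; grind

lemma S1 {k N : ℕ} (m M : Fin N → Fin (k + 2)) (hdiff : ∀ i, m i ≠ M i)
    (hbet : ∀ z a b, plt m z → plt z M → z a = m a → z b = M b → False)
    (i e : Fin N) (hi : i ∈ G m) (hMi : M i ≠ 0) (hei : e ≠ i)
    (hlt : zc M < zc m ∨ (zc m = zc M ∧ ∃ j, m j < M j ∧ j ≠ i ∧
      ∀ l, l ≠ j → (m l < M j ∧ M l < M j) ∨ (m l ≤ M j ∧ M l ≤ M j ∧ l < j))) : False := by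
  rw [mem_G] at hi
  have hmi : m i ≠ 0 := by rw [hi.1]; simp
  have z1 := zc_same m i (M i) hmi hMi
  have h1 := one_le_of_ne _ hMi
  have hd := hdiff i
  refine hbet (Function.update m i (M i)) e i ?_ ?_ (by simp [hei]) (by simp)
  · rw [plt_iff]; right
    refine ⟨by omega, i, ?_, ?_⟩
    · simp only [Function.update_apply]
      grind
    · intro l
      simp only [Function.update_apply]
      grind
  · rw [plt_iff]
    rcases hlt with hlt | ⟨hz, j, hj, hji, hb⟩
    · left; omega
    · right
      refine ⟨by omega, j, ?_, ?_⟩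
      · simp only [Function.update_apply]
        grind
      · intro l
        have := hb l
        simp only [Function.update_apply]
        grind

lemma S3 {k N : ℕ} (m M : Fin N → Fin (k + 2)) (hdiff : ∀ i, m i ≠ M i)
    (hbet : ∀ z a b, plt m z → plt z M → z a = m a → z b = M b → False)
    (j c : Fin N) (hj : j ∈ G m) (hjM : m j < M j) (hGM : G M = ∅) (hz : zc m = zc M)
    (hb : ∀ l, l ≠ j → (m l < M j ∧ M l < M j) ∨ (m l ≤ M j ∧ M l ≤ M j ∧ l < j))
    (hc : m c = 0) : False := by
  rw [mem_G] at hj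
  have hcj : c ≠ j := by rintro rfl; rw [hj.1] at hc; simp at hc
  have hjc : j < c := by
    by_contra hn
    exact hj.2 c (by omega) hc
  have hMc : M c ≠ 0 := by intro h; exact hdiff c (hc.trans h.symm)
  have h1c := one_le_of_ne _ hMc
  have he : ∃ e, M e = 0 ∧ (M c = 1 → e < c) := by
    by_cases h1 : M c = 1
    · have : c ∉ G M := by rw [hGM]; simp
      rw [mem_G] at this
      push Not at this
      obtain ⟨l, hl, hl0⟩ := this h1
      exact ⟨l, hl0, fun _ => hl⟩
    · have := zc_pos_of m c hc
      obtain ⟨e, he⟩ := exists_zero_of_zc M (by omega)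
      exact ⟨e, he, fun h => absurd h h1⟩
  obtain ⟨e, he, hec⟩ := he
  have hec' : e ≠ c := by rintro rfl; exact hMc he
  have z1 := zc_zero M c hMc
  have z2 := zc_up (Function.update M c 0) e 1 (by rw [Function.update_of_ne hec']; exact he)
    (by simp)
  have hej : e ≠ j := by rintro rfl; rw [he] at hjM; simp at hjM
  have h0c := Fin.pos_iff_ne_zero.mpr hMc
  have h01 : (0 : Fin (k + 2)) < 1 := by simp
  refine hbet (Function.update (Function.update M c 0) e 1) c j ?_ ?_ ?_ ?_
  · rw [plt_iff]; right
    refine ⟨by omega, j, ?_, ?_⟩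
    · simp only [Function.update_apply]
      grind
    · intro l
      have := hb l
      simp only [Function.update_apply]
      grind
  · rw [plt_iff]; right
    refine ⟨by omega, c, ?_, ?_⟩
    · simp only [Function.update_apply]
      grind
    · intro l
      simp only [Function.update_apply]
      grind
  · simp only [Function.update_apply]; grind
  · simp only [Function.update_apply]; grind

lemma S4 {k N : ℕ} (m M : Fin N → Fin (k + 2)) (hdiff : ∀ i, m i ≠ M i)
    (hbet : ∀ z a b, plt m z → plt z M → z a = m a → z b = M b → False)
    (j c : Fin N) (hjM : m j < M j) (hz : zc m = zc M)
    (hb : ∀ l, l ≠ j → (m l < M j ∧ M l < M j) ∨ (m l ≤ M j ∧ M l ≤ M j ∧ l < j))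
    (hmc : m c ≠ 0) (hMc : M c ≠ 0) (hcj : c ≠ j) : M c < m c := by
  by_contra hn
  have hlt : m c < M c := lt_of_le_of_ne (not_lt.mp hn) (hdiff c)
  have z1 := zc_same M c (m c) hMc hmc
  refine hbet (Function.update M c (m c)) c j ?_ ?_ ?_ ?_
  · rw [plt_iff]; right
    refine ⟨by omega, j, ?_, ?_⟩
    · simp only [Function.update_apply]
      grind
    · intro l
      have := hb l
      simp only [Function.update_apply]
      grind
  · rw [plt_iff]; right
    refine ⟨by omega, c, ?_, ?_⟩
    · simp only [Function.update_apply]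
      grind
    · intro l
      simp only [Function.update_apply]
      grind
  · simp only [Function.update_apply]; grind
  · simp only [Function.update_apply]; grind

lemma struct_eq_aux {k N : ℕ} (m M : Fin N → Fin (k + 2)) (hdiff : ∀ i, m i ≠ M i)
    (hbet : ∀ z a b, plt m z → plt z M → z a = m a → z b = M b → False)
    (i j : Fin N) (hi : i ∈ G m) (hji : j ≠ i) (hMi : M i = 0) (hjM : m j < M j) (hz : zc m = zc M)
    (hb : ∀ l, l ≠ j → (m l < M j ∧ M l < M j) ∨ (m l ≤ M j ∧ M l ≤ M j ∧ l < j)) :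
    ∀ i, m i ≠ 0 → ∃ j, M j ≠ 0 ∧ Function.update M j 0 = Function.update m i 0 := by
  have hMj : M j ≠ 0 := by intro h; rw [h] at hjM; simp at hjM
  have h1j := one_le_of_ne _ hMj
  have hMz := zc_pos_of M i hMi
  obtain ⟨c, hc⟩ := exists_zero_of_zc m (by omega)
  have hi' := (mem_G _ _).mp hi
  have hci : c ≠ i := by rintro rfl; rw [hi'.1] at hc; simp at hc
  have S : ∀ c e, m c = 0 → e ≠ i → e ≠ c → (1 < M j ∨ c ≠ j) → False := fun c e h1 h2 h3 h4 =>
    S2 m M hdiff hbet i c e hi hMi h1 h2 h3 (Or.inr ⟨hz, j, hjM, hji, h4, hb⟩)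
  by_cases he : ∃ e, e ≠ i ∧ e ≠ c
  · exfalso
    obtain ⟨e, hei, hec⟩ := he
    by_cases h4 : 1 < M j ∨ c ≠ j
    · exact S c e hc hei hec h4
    · push Not at h4
      obtain ⟨h4, rfl⟩ := h4
      have h4' : M c = 1 := le_antisymm h4 h1j
      by_cases hme : m e = 0
      · exact S e c hme hci hec.symm (Or.inr hec)
      · have hMe : M e = 0 := by
          have h5 := hb e hec
          have h6 := one_le_of_ne _ hme
          have h7 := hdiff e
          have h8 := lt_one_iff0 (M e)
          have h9 := lt_one_iff0 (m e)
          rw [h4'] at h5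
          grind
        have hsub : rset m 0 ⊆ {c} := by
          intro l hl
          rw [mem_rset] at hl
          have hl0 : m l = 0 := Fin.ext hl
          rw [Finset.mem_singleton]
          by_contra hlc
          exact S l c hl0 hci (Ne.symm hlc) (Or.inr hlc)
        have hsub2 : ({i, e} : Finset (Fin N)) ⊆ rset M 0 := by
          intro l hl
          rw [Finset.mem_insert, Finset.mem_singleton] at hl
          rw [mem_rset]
          rcases hl with rfl | rfl
          · rw [hMi]; rfl
          · rw [hMe]; rfl
        have c1 := Finset.card_le_card hsub
        have c2 := Finset.card_le_card hsub2
        rw [Finset.card_pair hei.symm] at c2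
        rw [Finset.card_singleton] at c1
        unfold zc at hz
        omega
  · push Not at he
    intro i' hi'
    refine ⟨j, hMj, ?_⟩
    funext l
    have := he l
    have := he j hji
    have := he i'
    simp only [Function.update_apply]
    grind

lemma struct_main {k N : ℕ} (m M : Fin N → Fin (k + 2)) (hdiff : ∀ i, m i ≠ M i)
    (hbet : ∀ z a b, plt m z → plt z M → z a = m a → z b = M b → False)
    (hN : ∀ i : Fin N, ∃ e, e ≠ i) (hmM : plt m M) (hg : (G M).card < (G m).card) :
    (∀ i, m i ≠ 0 → ∃ j, M j ≠ 0 ∧ Function.update M j 0 = Function.update m i 0) ∨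
    ∃ j c, c ≠ j ∧ (∀ l, m l ≠ 0) ∧ (∀ l, M l ≠ 0) ∧ m j = 1 ∧ m j < M j ∧
      (∀ l, l ≠ j → (m l < M j ∧ M l < M j) ∨ (m l ≤ M j ∧ M l ≤ M j ∧ l < j)) ∧
      (∀ l, l ≠ j → M l < m l ∧ 1 < M l) := by
  rw [plt_iff] at hmM
  rcases hmM with hz | ⟨hz, j, hjM, hb⟩
  · exfalso
    obtain ⟨i, hi⟩ := Finset.card_pos.mp (lt_of_le_of_lt (Nat.zero_le _) hg)
    obtain ⟨e, he⟩ := hN i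
    by_cases hMi : M i = 0
    · have := zc_pos_of M i hMi
      obtain ⟨c, hc, c', hc', hne⟩ := Finset.one_lt_card.mp (show 1 < (rset m 0).card by
        unfold zc at *; omega)
      rw [mem_rset] at hc hc'
      have hc0 : m c = 0 := Fin.ext hc
      have hc0' : m c' = 0 := Fin.ext hc'
      have hi1 := ((mem_G _ _).mp hi).1
      have : c' ≠ i := by rintro rfl; rw [hi1] at hc0'; simp at hc0'
      exact S2 m M hdiff hbet i c c' hi hMi hc0 this hne.symm (Or.inl hz)
    · exact S1 m M hdiff hbet i e hi hMi he (Or.inl hz)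
  · replace hb := fun l => hb l (hdiff l)
    by_cases hall : ∀ i ∈ G m, i = j
    · right
      have hsub : G m ⊆ {j} := fun i hi => Finset.mem_singleton.mpr (hall i hi)
      have hc1 := Finset.card_le_card hsub
      rw [Finset.card_singleton] at hc1
      have hGM : G M = ∅ := Finset.card_eq_zero.mp (by omega)
      obtain ⟨i, hi⟩ := Finset.card_pos.mp (lt_of_le_of_lt (Nat.zero_le _) hg)
      have hj : j ∈ G m := by rw [← hall i hi]; exact hi
      have hm0 : ∀ l, m l ≠ 0 := fun l hl => S3 m M hdiff hbet j l hj hjM hGM hz hb hl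
      have hM0 : ∀ l, M l ≠ 0 := by
        rw [← zc_eq_zero_iff] at *; omega
      obtain ⟨c, hc⟩ := hN j
      refine ⟨j, c, hc, hm0, hM0, ((mem_G _ _).mp hj).1, hjM, hb, fun l hl => ⟨?_, ?_⟩⟩
      · exact S4 m M hdiff hbet j l hjM hz hb (hm0 l) (hM0 l) hl
      · apply lt_of_le_of_ne (one_le_of_ne _ (hM0 l))
        intro h1
        have : l ∈ G M := (mem_G _ _).mpr ⟨h1.symm, fun l' _ => hM0 l'⟩
        rw [hGM] at this; simp at this
    · left
      push Not at hall
      obtain ⟨i, hi, hij⟩ := hall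
      by_cases hMi : M i = 0
      · exact struct_eq_aux m M hdiff hbet i j hi hij.symm hMi hjM hz hb
      · exact (S1 m M hdiff hbet i j hi hMi hij.symm
          (Or.inr ⟨hz, j, hjM, hij.symm, hb⟩)).elim

lemma swapD {k N : ℕ} (A : Finset (Fin N → Fin (k + 2))) (m M : Fin N → Fin (k + 2))
    (hA : Stable A) (hm : m ∉ A) (hM : M ∈ A) (hmax : ∀ z, plt M z → z ∉ A)
    (j c : Fin N) (hcj : c ≠ j) (hm0 : ∀ l, m l ≠ 0) (hM0 : ∀ l, M l ≠ 0) (hmj : m j = 1)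
    (hb : ∀ l, l ≠ j → (m l < M j ∧ M l < M j) ∨ (m l ≤ M j ∧ M l ≤ M j ∧ l < j))
    (hc : ∀ l, l ≠ j → M l < m l ∧ 1 < M l) :
    ∃ A' : Finset (Fin N → Fin (k + 2)), A'.card = A.card ∧
      (dShadow A').card ≤ (dShadow A).card ∧ Phi A' < Phi A := by
  have hzm := (zc_eq_zero_iff m).mpr hm0
  have hzM := (zc_eq_zero_iff M).mpr hM0
  have hcc := hc c hcj
  have hbc := hb c hcj
  have hMcj : M c < M j := by grind
  have hv0 : ∀ v : Fin (k + 2), 1 ≤ v → v ≠ 0 := by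
    rintro v hv rfl; simp at hv
  set D := (Finset.Icc 1 (M c)).image fun v => Function.update M c v with hD
  set E := (Finset.Icc 1 (M c)).image fun v => Function.update m j v with hE
  have hDA : D ⊆ A := by
    intro y hy
    rw [hD, Finset.mem_image] at hy
    obtain ⟨v, hv, rfl⟩ := hy
    rw [Finset.mem_Icc] at hv
    rcases hv.2.lt_or_eq with h | h
    · refine hA _ M ?_ ⟨j, by simp [hcj.symm]⟩ hM
      rw [plt_iff]; right
      refine ⟨zc_same M c v (hM0 c) (hv0 v hv.1), c, by simpa using h, ?_⟩
      intro l
      simp only [Function.update_apply]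
      grind
    · rw [h]; simpa using hM
  have hEA : ∀ y ∈ E, y ∉ A := by
    intro y hy
    rw [hE, Finset.mem_image] at hy
    obtain ⟨v, hv, rfl⟩ := hy
    rw [Finset.mem_Icc] at hv
    rcases hv.1.lt_or_eq with h | h
    · intro hin
      refine hm (hA m _ ?_ ⟨c, by simp [hcj]⟩ hin)
      rw [plt_iff]; right
      refine ⟨(zc_same m j v (hm0 j) (hv0 v hv.1)).symm, j, by simpa [hmj] using h, ?_⟩
      intro l
      simp only [Function.update_apply]
      grind
    · rw [← h, ← hmj]; simpa using hm
  have hED : ∀ p ∈ E, ∀ q ∈ D, plt p q := by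
    intro p hp q hq
    rw [hE, Finset.mem_image] at hp
    rw [hD, Finset.mem_image] at hq
    obtain ⟨v, hv, rfl⟩ := hp
    obtain ⟨w, hw, rfl⟩ := hq
    rw [Finset.mem_Icc] at hv hw
    have z1 := zc_same m j v (hm0 j) (hv0 v hv.1)
    have z2 := zc_same M c w (hM0 c) (hv0 w hw.1)
    rw [plt_iff]; right
    refine ⟨by omega, j, ?_, ?_⟩
    · simp only [Function.update_apply]
      grind
    · intro l
      have := hb l
      simp only [Function.update_apply]
      grind
  have hDc : D.card = (Finset.Icc 1 (M c)).card := by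
    apply Finset.card_image_of_injective
    exact Function.update_injective M c
  have hEc : E.card = (Finset.Icc 1 (M c)).card := by
    apply Finset.card_image_of_injective
    exact Function.update_injective m j
  have hdisj : Disjoint (A \ D) E := by
    rw [Finset.disjoint_left]
    intro y hy hyE
    exact hEA y hyE (Finset.mem_sdiff.mp hy).1
  have hmE : m ∈ E := by
    rw [hE, Finset.mem_image]
    refine ⟨1, Finset.mem_Icc.mpr ⟨le_rfl, hcc.2.le⟩, ?_⟩
    rw [← hmj]; simp
  have hcard : ((A \ D) ∪ E).card = A.card := by
    rw [Finset.card_union_of_disjoint hdisj]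
    have := Finset.card_sdiff_add_card_eq_card hDA
    omega
  refine ⟨(A \ D) ∪ E, hcard, ?_, ?_⟩
  · have hmem : Function.update M c 0 ∈ dShadow A := by
      rw [mem_dShadow]; exact ⟨M, hM, c, hM0 c, rfl⟩
    have hsub : dShadow ((A \ D) ∪ E) ⊆
        insert (Function.update m j 0) ((dShadow A).erase (Function.update M c 0)) := by
      intro y hy
      rw [mem_dShadow] at hy
      obtain ⟨u, hu, i, hi, rfl⟩ := hy
      rw [Finset.mem_insert, Finset.mem_erase]
      rw [Finset.mem_union, Finset.mem_sdiff] at hu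
      rcases hu with ⟨huA, huD⟩ | huE
      · right
        refine ⟨?_, (mem_dShadow _ _).mpr ⟨u, huA, i, hi, rfl⟩⟩
        intro h
        have hic : i = c := by
          by_contra hne
          have := congrFun h i
          rw [Function.update_self, Function.update_of_ne hne] at this
          exact hM0 i this.symm
        subst hic
        have hu : u = Function.update M i (u i) := by
          funext l
          have := congrFun h l
          simp only [Function.update_apply] at *
          grind
        have h1 := one_le_of_ne _ hi
        by_cases hle : u i ≤ M i
        · apply huD
          rw [hD, Finset.mem_image]
          exact ⟨u i, Finset.mem_Icc.mpr ⟨h1, hle⟩, hu.symm⟩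
        · refine hmax u ?_ huA
          have z1 := zc_same M i (u i) (hM0 i) hi
          rw [← hu] at z1
          rw [plt_iff]; right
          refine ⟨z1.symm, i, not_le.mp hle, ?_⟩
          intro l hl hli
          rw [hu] at hl
          simp [hli] at hl
      · rw [hE, Finset.mem_image] at huE
        obtain ⟨v, hv, rfl⟩ := huE
        rw [Finset.mem_Icc] at hv
        by_cases hij : i = j
        · left; subst hij; simp
        · right
          constructor
          · intro h
            have := congrFun h j
            rw [Function.update_of_ne (Ne.symm hij), Function.update_self,
              Function.update_of_ne hcj.symm] at this
            rw [this] at hv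
            exact absurd hv.2 (not_le.mpr hMcj)
          · have z1 := zc_same m j v (hm0 j) (hv0 v hv.1)
            have z2 := zc_same (Function.update m j v) i 1 hi (by simp)
            have z3 := zc_same M i 1 (hM0 i) (by simp)
            have hci := hc i hij
            have hM1 : Function.update M i 1 ∈ A := by
              refine hA _ M ?_ ⟨j, by simp [Ne.symm hij]⟩ hM
              rw [plt_iff]; right
              refine ⟨z3, i, by simpa using hci.2, ?_⟩
              intro l
              simp only [Function.update_apply]
              grind
            have hu' : Function.update (Function.update m j v) i 1 ∈ A := by
              refine hA _ _ ?_ ⟨i, by simp⟩ hM1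
              rw [plt_iff]; right
              refine ⟨by omega, j, ?_, ?_⟩
              · simp only [Function.update_apply]
                grind
              · intro l
                have := hb l
                simp only [Function.update_apply]
                grind
            rw [mem_dShadow]
            exact ⟨_, hu', i, by simp, by simp⟩
    have h1 := Finset.card_le_card hsub
    have h2 := Finset.card_insert_le (Function.update m j 0)
      ((dShadow A).erase (Function.update M c 0))
    have h3 := Finset.card_erase_add_one hmem
    omega
  · unfold Phi
    apply sum_swap' _ _ _ hcard
    · intro h
      exact hm (h ▸ Finset.mem_union_right _ hmE)
    · intro p hp q hq
      apply rk_lt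
      apply hED
      · rw [Finset.mem_sdiff, Finset.mem_union, Finset.mem_sdiff] at hp
        tauto
      · rw [Finset.mem_sdiff, Finset.mem_union, Finset.mem_sdiff] at hq
        tauto

lemma swap_main {k N : ℕ} (A : Finset (Fin N → Fin (k + 2))) (hA : Stable A) (hDC : ¬ DC A) :
    ∃ A' : Finset (Fin N → Fin (k + 2)), A'.card = A.card ∧
      (dShadow A').card ≤ (dShadow A).card ∧ Phi A' < Phi A := by
  unfold DC at hDC
  push Not at hDC
  obtain ⟨y0, hy0, x0, hxy, hx0⟩ := hDC
  obtain ⟨m, hm, hmin⟩ := Finset.exists_min_image (Finset.univ.filter fun x => x ∉ A) rk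
    ⟨x0, by simpa using hx0⟩
  obtain ⟨M, hM, hmax⟩ := Finset.exists_max_image A rk ⟨y0, hy0⟩
  simp only [Finset.mem_filter, Finset.mem_univ, true_and] at hm hmin
  have hmM : plt m M := by
    rw [← rk_lt_iff]
    have h1 := hmin x0 hx0
    have h2 := hmax y0 hy0
    have h3 := rk_lt hxy
    omega
  replace hmin : ∀ z, plt z m → z ∈ A := by
    intro z hz
    by_contra h
    have := hmin z h
    have := rk_lt hz
    omega
  replace hmax : ∀ z, plt M z → z ∉ A := by
    intro z hz h
    have := hmax z h
    have := rk_lt hz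
    omega
  have hdiff : ∀ i, m i ≠ M i := fun i h => hm (hA m M hmM ⟨i, h⟩ hM)
  have hbet : ∀ z a b, plt m z → plt z M → z a = m a → z b = M b → False :=
    fun z a b h1 h2 h3 h4 => hm (hA m z h1 ⟨a, h3.symm⟩ (hA z M h2 ⟨b, h4⟩ hM))
  have hsingle : (dShadow (insert m (A.erase M))).card ≤ (dShadow A).card →
      ∃ A' : Finset (Fin N → Fin (k + 2)), A'.card = A.card ∧
      (dShadow A').card ≤ (dShadow A).card ∧ Phi A' < Phi A := by
    intro h
    have hc : (insert m (A.erase M)).card = A.card := by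
      rw [Finset.card_insert_of_notMem (fun h => hm (Finset.mem_erase.mp h).2)]
      exact Finset.card_erase_add_one hM
    refine ⟨insert m (A.erase M), hc, h, ?_⟩
    unfold Phi
    apply sum_swap' _ _ _ hc
    · intro h
      exact hm (h ▸ Finset.mem_insert_self _ _)
    · intro p hp q hq
      have hp' : p = m := by
        rw [Finset.mem_sdiff, Finset.mem_insert, Finset.mem_erase] at hp
        tauto
      have hq' : q = M := by
        rw [Finset.mem_sdiff, Finset.mem_insert, Finset.mem_erase] at hq
        tauto
      rw [hp', hq']
      exact rk_lt hmM
  by_cases hg : (G m).card ≤ (G M).card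
  · exact hsingle (swapA A m M hmin hM hmax hmM hg)
  by_cases hN : ∀ i : Fin N, ∃ e, e ≠ i
  · rcases struct_main m M hdiff hbet hN hmM (by omega) with h | h
    · exact hsingle (swapB A m M hM h)
    · obtain ⟨j, c, hcj, hm0, hM0, hmj, -, hb, hc⟩ := h
      exact swapD A m M hA hm hM hmax j c hcj hm0 hM0 hmj hb hc
  · push Not at hN
    obtain ⟨i, hi⟩ := hN
    apply hsingle (swapB A m M hM ?_)
    intro i' hi'
    refine ⟨i, ?_, ?_⟩
    · intro hMi
      have h1 : zc M = zc m + 1 := by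
        have hMm : M = Function.update m i 0 := by
          funext l; rw [hi l]; simpa using hMi
        rw [hMm]
        exact zc_zero m i (by rw [← hi i']; exact hi')
      rw [plt_iff] at hmM
      clear hsingle
      omega
    · funext l
      rw [hi l, hi i']; simp

theorem main_thm {k : ℕ} (N : ℕ) : ∀ A : Finset (Fin N → Fin (k + 2)),
    (dShadow (initSeg (k + 1) N A.card)).card ≤ (dShadow A).card := by
  induction N with
  | zero =>
    intro A
    have : dShadow (initSeg (k + 1) 0 A.card) = ∅ := by
      rw [Finset.eq_empty_iff_forall_notMem]
      intro x hx
      rw [mem_dShadow] at hx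
      obtain ⟨_, _, i, _⟩ := hx
      exact i.elim0
    rw [this]; simp
  | succ n IH =>
    have key : ∀ (p : ℕ) (A : Finset (Fin (n + 1) → Fin (k + 2))), Phi A = p →
        (dShadow (initSeg (k + 1) (n + 1) A.card)).card ≤ (dShadow A).card := by
      intro p
      induction p using Nat.strong_induction_on with
      | _ p ih =>
        intro A hp
        by_cases hS : Stable A
        · by_cases hD : DC A
          · rw [DC_eq (initSeg_DC (k + 1) (n + 1) A.card) hD (initSeg_card' A)]
          · obtain ⟨A', h1, h2, h3⟩ := swap_main A hS hD
            have := ih _ (hp ▸ h3) A' rfl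
            rw [h1] at this
            exact this.trans h2
        · unfold Stable at hS
          push Not at hS
          obtain ⟨x, y, hxy, ⟨s, hs⟩, hy, hx⟩ := hS
          have h3 := compress_Phi s A x y hxy hs hy hx
          have := ih _ (hp ▸ h3) (compress s A) rfl
          rw [compress_card] at this
          exact this.trans (claim_step IH A s)
    exact fun A => key _ A rfl


/-- **Claim 1.** Let `k ≥ 1` and `n ≥ 2`. For every `A ⊆ [k]^n` and every coordinate `s`,
the `C_s`-compression satisfies `|C_s(A)| = |A|` and `|d(A)| ≥ |d(C_s(A))|`.
(Dimension `n ≥ 2` is rendered as `n + 1` with `n ≥ 1`; alphabet `[k]`, `k ≥ 1`,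
as `Fin (k+1)`.) -/
theorem claim1_compression (k n : ℕ) (hn : 1 ≤ n)
    (A : Finset (Fin (n + 1) → Fin (k + 1))) (s : Fin (n + 1)) :
    (compress s A).card = A.card ∧ (dShadow (compress s A)).card ≤ (dShadow A).card := by
  refine ⟨compress_card s A, ?_⟩
  cases k with
  | zero =>
    have : dShadow (compress s A) = ∅ := by
      rw [Finset.eq_empty_iff_forall_notMem]
      intro x hx
      rw [mem_dShadow] at hx
      obtain ⟨u, _, i, hi, _⟩ := hx
      exact hi (Fin.ext (by omega))
    rw [this]; simp
  | succ k => exact claim_step (main_thm n) A s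
end
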